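/- Let K be a field, n ≥ 2 an integer, and d ≥ 1 an integer. Then L_n and the matrix ring M_d(L_n) are isomorphic as K-algebras if and only if gcd(d, n−1) = 1. -/

import Mathlib

open scoped BigOperators

/-- Defining relations of the Leavitt algebra `L_K(1,n)`. -/
inductive LeavittRel (K : Type) [Field K] (n : ℕ) :
    FreeAlgebra K (Fin n ⊕ Fin n) → FreeAlgebra K (Fin n ⊕ Fin n) → Prop
  | xy (i j : Fin n) :
      LeavittRel K n (FreeAlgebra.ι K (Sum.inl i) * FreeAlgebra.ι K (Sum.inr j))
        (if i = j then 1 else 0)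
  | yx :
      LeavittRel K n (∑ j : Fin n, FreeAlgebra.ι K (Sum.inr j) * FreeAlgebra.ι K (Sum.inl j)) 1

/-- The Leavitt algebra `L_n = L_K(1,n)`. -/
abbrev Leavitt (K : Type) [Field K] (n : ℕ) := RingQuot (LeavittRel K n)

/-- The generator `x_i` of the Leavitt algebra. -/
noncomputable def lx (K : Type) [Field K] (n : ℕ) (i : Fin n) : Leavitt K n :=
  RingQuot.mkAlgHom K (LeavittRel K n) (FreeAlgebra.ι K (Sum.inl i))

/-- The generator `y_i` of the Leavitt algebra. -/
noncomputable def ly (K : Type) [Field K] (n : ℕ) (i : Fin n) : Leavitt K n :=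
  RingQuot.mkAlgHom K (LeavittRel K n) (FreeAlgebra.ι K (Sum.inr i))

/-- `x_I = x_{i_k} ⋯ x_{i_1}` for a word `I = (i_1, …, i_k)`. -/
noncomputable def xW (K : Type) [Field K] (n : ℕ) (I : List (Fin n)) : Leavitt K n :=
  (I.reverse.map (lx K n)).prod

/-- `y_I = y_{i_1} ⋯ y_{i_k}` for a word `I = (i_1, …, i_k)`. -/
noncomputable def yW (K : Type) [Field K] (n : ℕ) (I : List (Fin n)) : Leavitt K n :=
  (I.map (ly K n)).prod

/-- Auxiliary anti-homomorphism used to construct the involution on `L_n`. -/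
noncomputable def leavittStarAux (K : Type) [Field K] (n : ℕ) :
    FreeAlgebra K (Fin n ⊕ Fin n) →ₐ[K] (Leavitt K n)ᵐᵒᵖ :=
  FreeAlgebra.lift K fun s =>
    MulOpposite.op (RingQuot.mkAlgHom K (LeavittRel K n) (FreeAlgebra.ι K s.swap))

theorem leavittStarAux_rel (K : Type) [Field K] (n : ℕ) :
    ∀ ⦃a b : FreeAlgebra K (Fin n ⊕ Fin n)⦄, LeavittRel K n a b →
      leavittStarAux K n a = leavittStarAux K n b := by
  intro a b h
  induction h with
  | xy i j =>
    have h1 : (RingQuot.mkAlgHom K (LeavittRel K n))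
        (FreeAlgebra.ι K (Sum.inl j) * FreeAlgebra.ι K (Sum.inr i)) =
        (RingQuot.mkAlgHom K (LeavittRel K n)) (if j = i then 1 else 0) :=
      RingQuot.mkAlgHom_rel K (LeavittRel.xy j i)
    simp only [leavittStarAux, map_mul, FreeAlgebra.lift_ι_apply, Sum.swap_inl, Sum.swap_inr]
    rw [← MulOpposite.op_mul, ← map_mul, h1]
    by_cases hij : i = j
    · subst hij; simp
    · simp [hij, Ne.symm hij]
  | yx =>
    have h1 : (RingQuot.mkAlgHom K (LeavittRel K n))
        (∑ j : Fin n, FreeAlgebra.ι K (Sum.inr j) * FreeAlgebra.ι K (Sum.inl j)) =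
        (RingQuot.mkAlgHom K (LeavittRel K n)) 1 :=
      RingQuot.mkAlgHom_rel K LeavittRel.yx
    simp only [leavittStarAux, map_sum, map_mul, FreeAlgebra.lift_ι_apply, Sum.swap_inl,
      Sum.swap_inr, map_one]
    have key : ∀ x : Fin n,
        MulOpposite.op ((RingQuot.mkAlgHom K (LeavittRel K n)) (FreeAlgebra.ι K (Sum.inl x))) *
          MulOpposite.op ((RingQuot.mkAlgHom K (LeavittRel K n)) (FreeAlgebra.ι K (Sum.inr x))) =
        MulOpposite.opAddEquiv ((RingQuot.mkAlgHom K (LeavittRel K n))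
          (FreeAlgebra.ι K (Sum.inr x) * FreeAlgebra.ι K (Sum.inl x))) := by
      intro x; rw [map_mul]; rfl
    rw [Finset.sum_congr rfl fun x _ => key x, ← map_sum, ← map_sum, h1, map_one]
    rfl

/-- The involution `*` on the Leavitt algebra, as an algebra map into the opposite algebra. -/
noncomputable def lstarHom (K : Type) [Field K] (n : ℕ) :
    Leavitt K n →ₐ[K] (Leavitt K n)ᵐᵒᵖ :=
  RingQuot.liftAlgHom K ⟨leavittStarAux K n, leavittStarAux_rel K n⟩

/-- The involution `*` on the Leavitt algebra: the unique `K`-linear ring anti-automorphism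
with `x_i* = y_i` and `y_i* = x_i`. -/
noncomputable def lstar (K : Type) [Field K] (n : ℕ) (a : Leavitt K n) : Leavitt K n :=
  (lstarHom K n a).unop

/-- An element of `L_n` which is a finite (possibly empty) sum of monomials `y_I x_J`. -/
def IsSumYX (K : Type) [Field K] (n : ℕ) (a : Leavitt K n) : Prop :=
  ∃ (m : ℕ) (I J : Fin m → List (Fin n)), a = ∑ i, yW K n (I i) * xW K n (J i)

/-- The induced involution on matrices over `L_n`: `(A*)_{ij} = (A_{ji})*`. -/
noncomputable def mstar (K : Type) [Field K] (n r : ℕ)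
    (A : Matrix (Fin r) (Fin r) (Leavitt K n)) : Matrix (Fin r) (Fin r) (Leavitt K n) :=
  fun i j => lstar K n (A j i)

/-- The set `P_{n,r}` of unitary matrices over `L_n` all of whose entries are finite sums of
monomials `y_I x_J`. -/
def PsetM (K : Type) [Field K] (n r : ℕ) : Set (Matrix (Fin r) (Fin r) (Leavitt K n)) :=
  {A | (A * mstar K n r A = 1 ∧ mstar K n r A * A = 1) ∧ ∀ i j, IsSumYX K n (A i j)}

/-- `B` is a complete prefix code: a finite nonempty set of pairwise incomparable words such
that every word is comparable with some element of `B`. -/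
def IsCPC (n : ℕ) (B : Set (List (Fin n))) : Prop :=
  B.Finite ∧ B.Nonempty ∧ (∀ u ∈ B, ∀ v ∈ B, u ≠ v → ¬ u <+: v) ∧
    (∀ w : List (Fin n), ∃ u ∈ B, u <+: w ∨ w <+: u)

/-- A Leavitt family: elements satisfying the defining relations of a Leavitt algebra. -/
structure IsLeavittFamily {A ι : Type*} [Ring A] [Fintype ι] [DecidableEq ι] (X Y : ι → A) :
    Prop where
  mul_eq : ∀ i j, X i * Y j = if i = j then 1 else 0
  sum_eq : ∑ j, Y j * X j = 1

section Leavitt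

variable (K : Type) [Field K] (n : ℕ)

theorem lx_mul_ly (i j : Fin n) : lx K n i * ly K n j = if i = j then 1 else 0 := by
  rw [lx, ly, ← map_mul, RingQuot.mkAlgHom_rel K (LeavittRel.xy i j)]
  split_ifs <;> simp

theorem sum_ly_mul_lx : ∑ j, ly K n j * lx K n j = 1 := by
  simp only [lx, ly, ← map_mul, ← map_sum]
  rw [RingQuot.mkAlgHom_rel K LeavittRel.yx, map_one]

variable {K n}

/-- The algebra homomorphism out of the Leavitt algebra attached to a Leavitt family. -/
noncomputable def leavittLift {A : Type*} [Ring A] [Algebra K A] {X Y : Fin n → A}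
    (h : IsLeavittFamily X Y) : Leavitt K n →ₐ[K] A :=
  RingQuot.liftAlgHom K ⟨FreeAlgebra.lift K (Sum.elim X Y), by
    intro a b hab
    induction hab with
    | xy i j => simp only [map_mul, FreeAlgebra.lift_ι_apply, Sum.elim_inl, Sum.elim_inr,
        h.mul_eq]; split_ifs <;> simp
    | yx => simpa using h.sum_eq⟩

theorem leavittLift_lx {A : Type*} [Ring A] [Algebra K A] {X Y : Fin n → A}
    (h : IsLeavittFamily X Y) (i : Fin n) : leavittLift (K := K) h (lx K n i) = X i := by
  simp [leavittLift, lx]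

theorem leavittLift_ly {A : Type*} [Ring A] [Algebra K A] {X Y : Fin n → A}
    (h : IsLeavittFamily X Y) (i : Fin n) : leavittLift (K := K) h (ly K n i) = Y i := by
  simp [leavittLift, ly]

theorem adjoin_lx_ly :
    Algebra.adjoin K (Set.range (lx K n) ∪ Set.range (ly K n)) = ⊤ := by
  have h := congrArg (Subalgebra.map (RingQuot.mkAlgHom K (LeavittRel K n)))
    (FreeAlgebra.adjoin_range_ι K (Fin n ⊕ Fin n))
  rw [AlgHom.map_adjoin, Algebra.map_top,
    (AlgHom.range_eq_top _).2 (RingQuot.mkAlgHom_surjective K _)] at h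
  rw [← h]
  congr 1
  rw [← Set.range_comp]
  ext a
  simp [lx, ly]

theorem leavitt_nontrivial (hn : 0 < n) : Nontrivial (Leavitt K n) := by
  have : Nonempty (Fin n) := ⟨⟨0, hn⟩⟩
  obtain ⟨σ⟩ : Nonempty (Fin n × ℕ ≃ ℕ) := nonempty_equiv_of_countable
  let X : Fin n → Module.End K (ℕ → K) := fun i => LinearMap.funLeft K K fun k => σ (i, k)
  let Y : Fin n → Module.End K (ℕ → K) := fun i =>
    { toFun := fun f m => if (σ.symm m).1 = i then f (σ.symm m).2 else 0
      map_add' := by intro f g; ext m; by_cases h : (σ.symm m).1 = i <;> simp [h]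
      map_smul' := by intro c f; ext m; simp }
  have h : IsLeavittFamily X Y :=
    { mul_eq := by
        intro i j
        refine LinearMap.ext fun f => ?_
        ext k
        by_cases hij : i = j <;> simp [X, Y, LinearMap.funLeft_apply, hij]
      sum_eq := by
        refine LinearMap.ext fun f => ?_
        ext k
        simp [X, Y, LinearMap.funLeft_apply, LinearMap.sum_apply, Finset.sum_apply] }
  exact (leavittLift (K := K) h).toRingHom.domain_nontrivial

theorem xW_cons (i : Fin n) (u : List (Fin n)) : xW K n (i :: u) = xW K n u * lx K n i := by
  simp [xW]

theorem yW_cons (i : Fin n) (u : List (Fin n)) : yW K n (i :: u) = ly K n i * yW K n u := by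
  simp [yW]

theorem yW_append (u v : List (Fin n)) : yW K n (u ++ v) = yW K n u * yW K n v := by
  simp [yW]

theorem xW_mul_yW_of_length_le (u w : List (Fin n)) (h : u.length ≤ w.length) :
    xW K n u * yW K n w = if u <+: w then yW K n (w.drop u.length) else 0 := by
  induction u generalizing w with
  | nil => simp [xW]
  | cons i u ih =>
    match w with
    | [] => simp at h
    | j :: w =>
      rw [xW_cons, yW_cons, mul_assoc, ← mul_assoc (lx K n i), lx_mul_ly]
      by_cases hij : i = j
      · simp [hij, ih w (by simpa using h)]
      · simp [hij]

theorem xW_mul_yW_self (u : List (Fin n)) : xW K n u * yW K n u = 1 := by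
  rw [xW_mul_yW_of_length_le u u le_rfl]
  simp [yW]

/-- A word with only trivial overlap with its left translates by short words. -/
theorem exists_word_not_prefix (hn : 2 ≤ n) (M : ℕ) :
    ∃ δ : List (Fin n), ∀ γ : List (Fin n), γ ≠ [] → γ.length ≤ M → ¬ δ <+: γ ++ δ := by
  let a : Fin n := ⟨0, by omega⟩
  let b : Fin n := ⟨1, by omega⟩
  refine ⟨List.replicate M a ++ [b], fun γ h0 hM h => ?_⟩
  have hpos : 0 < γ.length := List.length_pos_iff.2 h0
  have h1 := h.getElem (i := M) (by simp)
  rw [List.getElem_append_right (by simp), List.getElem_append_right (by omega),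
    List.getElem_append_left (by simp; omega)] at h1
  simp [a, b] at h1

/-- A nonzero combination of words `y_I` generates the unit ideal. -/
theorem exists_mul_linearCombination_yW_mul (hn : 2 ≤ n) (p : List (Fin n) →₀ K) (hp : p ≠ 0) :
    ∃ A B : Leavitt K n, A * Finsupp.linearCombination K (yW K n) p * B = 1 := by
  obtain ⟨β, hβ, hmin⟩ := Finset.exists_min_image p.support List.length
    (Finsupp.support_nonempty_iff.2 hp)
  obtain ⟨δ, hδ⟩ := exists_word_not_prefix hn (p.support.sup List.length)
  have key : ∀ w ∈ p.support,
      xW K n δ * xW K n β * yW K n w * yW K n δ = if w = β then 1 else 0 := by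
    intro w hw
    rw [mul_assoc (xW K n δ), xW_mul_yW_of_length_le _ _ (hmin w hw)]
    by_cases h : β <+: w
    · obtain ⟨γ, rfl⟩ := h
      by_cases hγ : γ = []
      · subst hγ
        simp only [List.append_nil, List.prefix_rfl, if_true, List.drop_length]
        rw [show yW K n [] = 1 by simp [yW], mul_one, xW_mul_yW_self]
      · have hlen : γ.length ≤ p.support.sup List.length :=
          le_trans (by simp) (Finset.le_sup (f := List.length) hw)
        simp [hγ, mul_assoc, ← yW_append,
          xW_mul_yW_of_length_le δ (γ ++ δ) (by simp), hδ γ hγ hlen]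
    · have : w ≠ β := by rintro rfl; exact h List.prefix_rfl
      simp [h, this]
  refine ⟨xW K n δ * xW K n β, (p β)⁻¹ • yW K n δ, ?_⟩
  rw [Finsupp.linearCombination_apply, Finsupp.sum, Finset.mul_sum, Finset.sum_mul,
    Finset.sum_congr rfl (g := fun w => if w = β then 1 else 0), Finset.sum_ite_eq', if_pos hβ]
  intro w hw
  simp only [mul_smul_comm, smul_mul_assoc, key w hw, smul_smul]
  split_ifs with h
  · subst h
    rw [inv_mul_cancel₀ (Finsupp.mem_support_iff.1 hw), one_smul]
  · simp

theorem linearCombination_yW_injective (hn : 2 ≤ n) :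
    Function.Injective (Finsupp.linearCombination K (yW K n)) := by
  have := leavitt_nontrivial (K := K) (n := n) (by omega)
  rw [injective_iff_map_eq_zero]
  intro p hp
  by_contra h0
  obtain ⟨A, B, h⟩ := exists_mul_linearCombination_yW_mul hn p h0
  simp [hp] at h

variable (K n) in
/-- The span of the words `y_I` of length at least `m`. -/
noncomputable def yFilt (m : ℕ) : Submodule K (Leavitt K n) :=
  Submodule.span K (Set.image (yW K n) {w | m ≤ w.length})

theorem yFilt_anti {m m' : ℕ} (h : m ≤ m') : yFilt K n m' ≤ yFilt K n m :=
  Submodule.span_mono (Set.image_mono fun _ hw => le_trans h hw)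

theorem yW_mem_yFilt (w : List (Fin n)) : yW K n w ∈ yFilt K n w.length :=
  Submodule.subset_span ⟨w, le_refl w.length, rfl⟩

theorem mul_mem_yFilt {m k : ℕ} {l : Leavitt K n}
    (h : ∀ w : List (Fin n), m ≤ w.length → l * yW K n w ∈ yFilt K n k) {f : Leavitt K n}
    (hf : f ∈ yFilt K n m) : l * f ∈ yFilt K n k := by
  have : yFilt K n m ≤ (yFilt K n k).comap (LinearMap.mulLeft K l) := by
    refine Submodule.span_le.2 ?_
    rintro _ ⟨w, hw, rfl⟩
    exact h w hw
  exact this hf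

/-- Left multiplications are continuous for the filtration by the length of words. -/
theorem exists_mul_mem_yFilt (l : Leavitt K n) (k : ℕ) :
    ∃ m, ∀ f ∈ yFilt K n m, l * f ∈ yFilt K n k := by
  have hl : l ∈ Algebra.adjoin K (Set.range (lx K n) ∪ Set.range (ly K n)) := by
    rw [adjoin_lx_ly]; trivial
  induction hl using Algebra.adjoin_induction generalizing k with
  | mem a ha =>
    rcases ha with ⟨i, rfl⟩ | ⟨i, rfl⟩
    · refine ⟨k + 1, fun f hf => mul_mem_yFilt (fun w hw => ?_) hf⟩
      match w with
      | [] => simp at hw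
      | j :: w =>
        rw [yW_cons, ← mul_assoc, lx_mul_ly]
        split_ifs
        · rw [one_mul]
          exact yFilt_anti (by simpa using hw) (yW_mem_yFilt w)
        · simp
    · refine ⟨k, fun f hf => mul_mem_yFilt (fun w hw => ?_) hf⟩
      rw [← yW_cons]
      exact yFilt_anti (by simp; omega) (yW_mem_yFilt (i :: w))
  | algebraMap c =>
    refine ⟨k, fun f hf => ?_⟩
    rw [← Algebra.smul_def]
    exact Submodule.smul_mem _ _ hf
  | add a b _ _ iha ihb =>
    obtain ⟨m, hm⟩ := iha k
    obtain ⟨m', hm'⟩ := ihb k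
    refine ⟨max m m', fun f hf => ?_⟩
    rw [add_mul]
    exact add_mem (hm f (yFilt_anti (le_max_left _ _) hf))
      (hm' f (yFilt_anti (le_max_right _ _) hf))
  | mul a b _ _ iha ihb =>
    obtain ⟨m, hm⟩ := iha k
    obtain ⟨m', hm'⟩ := ihb m
    refine ⟨m', fun f hf => ?_⟩
    rw [mul_assoc]
    exact hm _ (hm' f hf)

theorem eq_zero_of_mul_yW_eq_zero (m : ℕ) (a : Leavitt K n)
    (h : ∀ w : List (Fin n), w.length = m → a * yW K n w = 0) : a = 0 := by
  induction m generalizing a with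
  | zero => simpa [yW] using h [] rfl
  | succ m ih =>
    have h1 : ∀ i, a * ly K n i = 0 := fun i => ih _ fun w hw => by
      rw [mul_assoc, ← yW_cons]
      exact h _ (by simp [hw])
    rw [← mul_one a, ← sum_ly_mul_lx, Finset.mul_sum]
    exact Finset.sum_eq_zero fun i _ => by rw [← mul_assoc, h1, zero_mul]

theorem yFilt_zero : yFilt K n 0 = LinearMap.range (Finsupp.linearCombination K (yW K n)) := by
  rw [Finsupp.range_linearCombination, yFilt]
  congr 1
  ext
  simp

/-- Every nonzero element of the Leavitt algebra generates the unit ideal. -/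
theorem leavitt_exists_mul_mul_eq_one (hn : 2 ≤ n) (a : Leavitt K n) (ha : a ≠ 0) :
    ∃ A B : Leavitt K n, A * a * B = 1 := by
  obtain ⟨m, hm⟩ := exists_mul_mem_yFilt a 0
  obtain ⟨w, hw, hne⟩ : ∃ w : List (Fin n), w.length = m ∧ a * yW K n w ≠ 0 := by
    by_contra! h
    exact ha (eq_zero_of_mul_yW_eq_zero m a h)
  have hmem := hm _ (hw ▸ yW_mem_yFilt w)
  rw [yFilt_zero] at hmem
  obtain ⟨p, hp⟩ := hmem
  obtain ⟨A, B, h⟩ := exists_mul_linearCombination_yW_mul (K := K) hn p (by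
    rintro rfl
    exact hne (by rw [← hp, map_zero]))
  exact ⟨A, yW K n w * B, by rw [← h, hp]; simp only [mul_assoc]⟩

theorem leavittLift_injective {A : Type*} [Ring A] [Nontrivial A] [Algebra K A] (hn : 2 ≤ n)
    (φ : Leavitt K n →ₐ[K] A) : Function.Injective φ := by
  rw [injective_iff_map_eq_zero]
  intro a ha
  by_contra h0
  obtain ⟨A, B, h⟩ := leavitt_exists_mul_mul_eq_one hn a h0
  simpa [ha] using congrArg φ h

end Leavitt

section Codimension

variable {K B C D : Type*} [Field K] [AddCommGroup B] [Module K B] [AddCommGroup C] [Module K C]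
  [AddCommGroup D] [Module K D]

/-- The codimension of the range of a composition, when the outer map is injective. -/
theorem length_quotient_range_comp (g : C →ₗ[K] D) (f : B →ₗ[K] C) (hg : Function.Injective g) :
    Module.length K (D ⧸ LinearMap.range (g ∘ₗ f)) =
      Module.length K (C ⧸ LinearMap.range f) + Module.length K (D ⧸ LinearMap.range g) := by
  have h1 : LinearMap.range f ≤ (LinearMap.range (g ∘ₗ f)).comap g := by
    rintro _ ⟨b, rfl⟩
    exact ⟨b, rfl⟩
  refine Module.length_eq_add_of_exact (Submodule.mapQ _ _ g h1)
    (Submodule.factor (LinearMap.range_comp_le_range f g)) ?_ (Submodule.factor_surjective _) ?_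
  · rw [← LinearMap.ker_eq_bot, Submodule.mapQ, Submodule.ker_liftQ_eq_bot]
    intro c hc
    obtain ⟨b, hb⟩ : g c ∈ LinearMap.range (g ∘ₗ f) := by simpa using hc
    exact ⟨b, hg hb⟩
  · rw [LinearMap.exact_iff]
    refine le_antisymm (fun x hx => ?_) ?_
    · obtain ⟨x, rfl⟩ := Submodule.mkQ_surjective _ x
      obtain ⟨c, rfl⟩ : x ∈ LinearMap.range g := by simpa using hx
      exact ⟨Submodule.Quotient.mk c, rfl⟩
    · rintro _ ⟨c, rfl⟩
      obtain ⟨c, rfl⟩ := Submodule.mkQ_surjective _ c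
      simp

theorem length_quotient_range_compLeft {X : Type*} [Fintype X] [DecidableEq X] (f : B →ₗ[K] C) :
    Module.length K ((X → C) ⧸ LinearMap.range (f.compLeft X)) =
      Fintype.card X * Module.length K (C ⧸ LinearMap.range f) := by
  have h : LinearMap.range (f.compLeft X) =
      Submodule.pi Set.univ fun _ : X => LinearMap.range f := by
    ext c
    simp only [LinearMap.mem_range, Submodule.mem_pi, Set.mem_univ, true_implies]
    refine ⟨fun ⟨b, hb⟩ i => ⟨b i, by rw [← hb]; rfl⟩, fun h => ?_⟩
    choose b hb using h
    exact ⟨b, funext hb⟩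
  rw [h, (Submodule.quotientPi fun _ : X => LinearMap.range f).length_eq,
    Module.length_pi_of_fintype]
  simp

end Codimension

section FreeModule

variable (K : Type*) [Field K] (X α : Type*)

/-- Prefixing a letter to a word, on the free module over the free algebra with basis `α`. -/
noncomputable def prefixMap (i : X) : ((α × List X) →₀ K) →ₗ[K] ((α × List X) →₀ K) :=
  Finsupp.lmapDomain K K fun p => (p.1, i :: p.2)

theorem prefixMap_single (i : X) (a : α) (w : List X) (c : K) :
    prefixMap K X α i (Finsupp.single (a, w) c) = Finsupp.single (a, i :: w) c := by
  simp [prefixMap]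

theorem prefixMap_apply_cons [DecidableEq X] (i j : X) (p : (α × List X) →₀ K) (a : α)
    (w : List X) : prefixMap K X α i p (a, j :: w) = if i = j then p (a, w) else 0 := by
  have hinj : Function.Injective fun p : α × List X => (p.1, i :: p.2) := by
    rintro ⟨a, u⟩ ⟨b, v⟩ h
    simpa using h
  rw [prefixMap, Finsupp.lmapDomain_apply]
  split_ifs with h
  · subst h
    exact Finsupp.mapDomain_apply hinj p (a, w)
  · exact Finsupp.mapDomain_of_notMem_range p _ (by simp [h])

theorem prefixMap_apply_nil (i : X) (p : (α × List X) →₀ K) (a : α) :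
    prefixMap K X α i p (a, []) = 0 :=
  Finsupp.mapDomain_of_notMem_range p _ (by simp)

variable [Fintype X]

/-- The sum of all the maps prefixing a letter. -/
noncomputable def prefixSum : (X → ((α × List X) →₀ K)) →ₗ[K] ((α × List X) →₀ K) :=
  ∑ i, prefixMap K X α i ∘ₗ LinearMap.proj i

theorem prefixSum_apply (p : X → ((α × List X) →₀ K)) :
    prefixSum K X α p = ∑ i, prefixMap K X α i (p i) := by
  simp [prefixSum]

theorem prefixSum_apply_nil (p : X → ((α × List X) →₀ K)) (a : α) :
    prefixSum K X α p (a, []) = 0 := by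
  simp [prefixSum_apply, Finsupp.finsetSum_apply, prefixMap_apply_nil]

variable [DecidableEq X]

theorem prefixSum_apply_cons (p : X → ((α × List X) →₀ K)) (a : α) (j : X) (w : List X) :
    prefixSum K X α p (a, j :: w) = p j (a, w) := by
  simp [prefixSum_apply, Finsupp.finsetSum_apply, prefixMap_apply_cons]

theorem prefixSum_injective : Function.Injective (prefixSum K X α) := by
  intro p q h
  funext i
  ext ⟨a, w⟩
  rw [← prefixSum_apply_cons, h, prefixSum_apply_cons]

theorem length_quotient_range_prefixSum [Fintype α] :
    Module.length K (((α × List X) →₀ K) ⧸ LinearMap.range (prefixSum K X α)) =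
      Fintype.card α := by
  classical
  let R : ((α × List X) →₀ K) →ₗ[K] (α → K) := LinearMap.pi fun a => Finsupp.lapply (a, [])
  have hR : ∀ p a, R p a = p (a, []) := fun p a => rfl
  have hker : LinearMap.range (prefixSum K X α) = LinearMap.ker R := by
    ext p
    constructor
    · rintro ⟨q, rfl⟩
      ext a
      rw [hR, prefixSum_apply_nil]
      rfl
    · intro hp
      have hinj : ∀ i : X, Function.Injective fun p : α × List X => (p.1, i :: p.2) := by
        rintro i ⟨a, u⟩ ⟨b, v⟩ h
        simpa using h
      refine ⟨fun i => p.comapDomain (fun q => (q.1, i :: q.2)) (hinj i).injOn, ?_⟩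
      ext ⟨a, w⟩
      cases w with
      | nil => rw [prefixSum_apply_nil, ← hR, LinearMap.mem_ker.1 hp]; rfl
      | cons i w => rw [prefixSum_apply_cons]; rfl
  have hsurj : Function.Surjective R := by
    intro f
    refine ⟨∑ a, Finsupp.single (a, []) (f a), ?_⟩
    ext a
    simp [hR, Finsupp.finsetSum_apply, Finsupp.single_apply]
  rw [hker, (R.quotKerEquivOfSurjective hsurj).length_eq]
  simp

variable {K X α}

/-- The Schreier–Lewin formula for submodules of finite codimension that are free. -/
theorem card_add_eq_of_comp_prefixMap {β : Type*} [Fintype α] [Fintype β]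
    (ψ : ((β × List X) →₀ K) →ₗ[K] ((α × List X) →₀ K)) (hψ : Function.Injective ψ)
    (hcomm : ∀ i, ψ ∘ₗ prefixMap K X β i = prefixMap K X α i ∘ₗ ψ) :
    Fintype.card β + Module.length K (((α × List X) →₀ K) ⧸ LinearMap.range ψ) =
      Fintype.card X * Module.length K (((α × List X) →₀ K) ⧸ LinearMap.range ψ) +
        Fintype.card α := by
  have h : ψ ∘ₗ prefixSum K X β = prefixSum K X α ∘ₗ ψ.compLeft X := by
    refine LinearMap.ext fun p => ?_
    simp only [LinearMap.comp_apply, prefixSum_apply, map_sum]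
    exact Finset.sum_congr rfl fun i _ => LinearMap.congr_fun (hcomm i) (p i)
  have h1 := length_quotient_range_comp ψ (prefixSum K X β) hψ
  rw [h, length_quotient_range_comp _ _ (prefixSum_injective K X α),
    length_quotient_range_compLeft, length_quotient_range_prefixSum,
    length_quotient_range_prefixSum] at h1
  exact h1.symm

end FreeModule

section ModuleType

variable {K : Type} [Field K] {n : ℕ}

theorem exists_mulVec_mem_yFilt {I J : Type*} [Fintype I] [Fintype J] (U : Matrix I J (Leavitt K n))
    (k : ℕ) : ∃ m, ∀ f : J → Leavitt K n, (∀ j, f j ∈ yFilt K n m) →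
      ∀ i, U.mulVec f i ∈ yFilt K n k := by
  choose m hm using fun i j => exists_mul_mem_yFilt (U i j) k
  refine ⟨Finset.univ.sup fun p : I × J => m p.1 p.2, fun f hf i => ?_⟩
  refine Submodule.sum_mem _ fun j _ => hm i j _ (yFilt_anti ?_ (hf j))
  exact Finset.le_sup (f := fun p : I × J => m p.1 p.2) (Finset.mem_univ (i, j))

variable (K n) in
/-- The `K`-linear map from a free module over the free algebra to a free module over the Leavitt
algebra which identifies basis vectors with words of length `m`. -/
noncomputable def wordMap (J : Type*) [DecidableEq J] (m : ℕ) :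
    (((J × List.Vector (Fin n) m) × List (Fin n)) →₀ K) →ₗ[K] (J → Leavitt K n) :=
  Finsupp.linearCombination K fun p => Pi.single p.1.1 (yW K n (p.1.2.toList ++ p.2.reverse))

variable {J : Type*} [DecidableEq J] {m : ℕ}

theorem wordMap_single (p : (J × List.Vector (Fin n) m) × List (Fin n)) (c : K) :
    wordMap K n J m (Finsupp.single p c) =
      c • Pi.single p.1.1 (yW K n (p.1.2.toList ++ p.2.reverse)) := by
  simp [wordMap]

theorem wordMap_injective [Finite J] (hn : 2 ≤ n) : Function.Injective (wordMap K n J m) := by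
  have := Fintype.ofFinite J
  have h : LinearIndependent K fun ji : Σ _ : J, List (Fin n) =>
      (Pi.single ji.1 (yW K n ji.2) : J → Leavitt K n) :=
    Pi.linearIndependent_single (fun _ : J => yW K n) fun _ => linearCombination_yW_injective hn
  refine h.comp (fun p : (J × List.Vector (Fin n) m) × List (Fin n) =>
    ⟨p.1.1, p.1.2.toList ++ p.2.reverse⟩) ?_
  rintro ⟨⟨j, v⟩, w⟩ ⟨⟨j', v'⟩, w'⟩ h
  simp only [Sigma.mk.injEq, heq_eq_eq] at h
  obtain ⟨h1, h2⟩ := List.append_inj h.2 (by simp)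
  rw [h.1, List.Vector.eq v v' h1, List.reverse_injective h2]

theorem wordMap_prefixMap (i : Fin n) (p : ((J × List.Vector (Fin n) m) × List (Fin n)) →₀ K)
    (j : J) : wordMap K n J m (prefixMap K _ _ i p) j = wordMap K n J m p j * ly K n i := by
  induction p using Finsupp.induction_linear with
  | zero => simp
  | add p q hp hq => simp [hp, hq, add_mul]
  | single p c =>
    rw [prefixMap_single, wordMap_single, wordMap_single]
    rcases eq_or_ne j p.1.1 with rfl | h
    · simp [← List.append_assoc, yW_append _ [i], show yW K n [i] = ly K n i by simp [yW]]
    · simp [h]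

theorem wordMap_mem_yFilt (p : ((J × List.Vector (Fin n) m) × List (Fin n)) →₀ K) (j : J) :
    wordMap K n J m p j ∈ yFilt K n m := by
  induction p using Finsupp.induction_linear with
  | zero => simp
  | add p q hp hq => simpa using add_mem hp hq
  | single p c =>
    rw [wordMap_single]
    rcases eq_or_ne j p.1.1 with rfl | h
    · simpa using Submodule.smul_mem _ c (yFilt_anti (by simp) (yW_mem_yFilt _))
    · simp [h]

theorem exists_wordMap_eq [Fintype J] (f : J → Leavitt K n) (hf : ∀ j, f j ∈ yFilt K n m) :
    ∃ p, wordMap K n J m p = f := by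
  have h : ∀ j, yFilt K n m ≤
      (LinearMap.range (wordMap K n J m)).comap (LinearMap.single K (fun _ => Leavitt K n) j) := by
    refine fun j => Submodule.span_le.2 ?_
    rintro _ ⟨w, hw, rfl⟩
    refine ⟨Finsupp.single ((j, ⟨w.take m, by simpa using hw⟩), (w.drop m).reverse) 1, ?_⟩
    rw [wordMap_single]
    simp [List.Vector.toList]
  have h2 : f = ∑ j, Pi.single j (f j) := (Finset.univ_sum_single f).symm
  have h3 : f ∈ LinearMap.range (wordMap K n J m) := by
    rw [h2]
    exact Submodule.sum_mem _ fun j _ => h j (hf j)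
  exact h3

/-- The Leavitt algebra has module type `(1, n - 1)`: an invertible matrix of format `I × J`
forces `|I| ≡ |J|` modulo `n - 1`. -/
theorem card_modEq_of_mul_eq_one {I J : Type*} [Fintype I] [DecidableEq I] [Fintype J]
    [DecidableEq J] (hn : 2 ≤ n) (U : Matrix I J (Leavitt K n)) (V : Matrix J I (Leavitt K n))
    (hUV : U * V = 1) (hVU : V * U = 1) : Fintype.card I ≡ Fintype.card J [MOD (n - 1)] := by
  obtain ⟨m, hm⟩ := exists_mulVec_mem_yFilt U 0
  obtain ⟨m', hm'⟩ := exists_mulVec_mem_yFilt V m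
  let P := ((I × List.Vector (Fin n) 0) × List (Fin n)) →₀ K
  let Q := ((J × List.Vector (Fin n) m) × List (Fin n)) →₀ K
  have hP : Function.Injective (wordMap K n I 0) := wordMap_injective hn
  have hinj : Function.Injective U.mulVec :=
    Function.LeftInverse.injective (g := V.mulVec) fun f => by
      rw [Matrix.mulVec_mulVec, hVU, Matrix.one_mulVec]
  let T : (J → Leavitt K n) →ₗ[K] (I → Leavitt K n) :=
    { toFun := U.mulVec
      map_add' := U.mulVec_add
      map_smul' := fun c f => U.mulVec_smul c f }
  have hT : ∀ q, T (wordMap K n J m q) ∈ LinearMap.range (wordMap K n I 0) := fun q =>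
    exists_wordMap_eq _ (hm _ (wordMap_mem_yFilt q))
  obtain ⟨ψ, hψ⟩ : ∃ ψ : Q →ₗ[K] P, ∀ q,
      wordMap K n I 0 (ψ q) = U.mulVec (wordMap K n J m q) :=
    ⟨(LinearEquiv.ofInjective _ hP).symm.toLinearMap ∘ₗ (T ∘ₗ wordMap K n J m).codRestrict _ hT,
      fun q => LinearEquiv.ofInjective_symm_apply (f := wordMap K n I 0) (h := hP) ⟨_, hT q⟩⟩
  have hψinj : Function.Injective ψ := fun p q h =>
    wordMap_injective hn (hinj (by rw [← hψ, ← hψ, h]))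
  have hcomm : ∀ i, ψ ∘ₗ prefixMap K _ _ i = prefixMap K _ _ i ∘ₗ ψ := by
    refine fun i => LinearMap.ext fun q => hP (funext fun k => ?_)
    rw [LinearMap.comp_apply, LinearMap.comp_apply, wordMap_prefixMap, hψ, hψ]
    simp only [Matrix.mulVec, dotProduct, Finset.sum_mul, mul_assoc]
    exact Finset.sum_congr rfl fun j _ => congrArg _ (wordMap_prefixMap i q j)
  have hlong : ∀ p : (I × List.Vector (Fin n) 0) × List (Fin n), m' ≤ p.2.length →
      Finsupp.single p 1 ∈ LinearMap.range ψ := by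
    intro p hp
    obtain ⟨q, hq⟩ := exists_wordMap_eq (V.mulVec (wordMap K n I 0 (Finsupp.single p 1)))
      (m := m) (hm' _ fun i => by
        rw [wordMap_single]
        rcases eq_or_ne i p.1.1 with rfl | h
        · simpa using yFilt_anti (by simpa using hp) (yW_mem_yFilt _)
        · simp [h])
    refine ⟨q, hP ?_⟩
    rw [hψ, hq, Matrix.mulVec_mulVec, hUV, Matrix.one_mulVec]
  have hfin : Module.Finite K (P ⧸ LinearMap.range ψ) := by
    let S : Set ((I × List.Vector (Fin n) 0) × List (Fin n)) := {p | p.2.length < m'}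
    have hS : S.Finite := by
      refine (Set.finite_univ.prod (List.finite_length_lt (Fin n) m')).subset ?_
      exact fun p hp => ⟨trivial, hp⟩
    refine ⟨Submodule.fg_def.2
      ⟨_, hS.image fun p => (LinearMap.range ψ).mkQ (Finsupp.single p 1), ?_⟩⟩
    have htop : (⊤ : Submodule K (P ⧸ LinearMap.range ψ)) = (Submodule.span K
        (Set.range fun p => Finsupp.single p (1 : K))).map (LinearMap.range ψ).mkQ := by
      rw [← Finsupp.coe_basisSingleOne, Module.Basis.span_eq, Submodule.map_top,
        Submodule.range_mkQ]
    rw [eq_top_iff, htop, Submodule.map_span, Submodule.span_le]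
    rintro _ ⟨_, ⟨p, rfl⟩, rfl⟩
    by_cases hp : p.2.length < m'
    · exact Submodule.subset_span ⟨p, hp, rfl⟩
    · have := (Submodule.Quotient.mk_eq_zero (LinearMap.range ψ)).2 (hlong p (not_lt.1 hp))
      simp only [Submodule.mkQ_apply, this, SetLike.mem_coe, zero_mem]
  have hcount := card_add_eq_of_comp_prefixMap ψ hψinj hcomm
  obtain ⟨c, hc⟩ := ENat.ne_top_iff_exists.1
    (Module.length_ne_top (R := K) (M := P ⧸ LinearMap.range ψ))
  rw [← hc] at hcount
  simp only [Fintype.card_prod, card_vector, Fintype.card_fin] at hcount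
  norm_cast at hcount
  have h1 : n ≡ 1 [MOD (n - 1)] := ((Nat.modEq_iff_dvd' (by omega)).2 dvd_rfl).symm
  have h2 : Fintype.card J * n ^ m + c ≡ Fintype.card J * 1 ^ m + c [MOD (n - 1)] :=
    ((h1.pow m).mul_left _).add_right _
  have h3 : n * c + Fintype.card I * n ^ 0 ≡ 1 * c + Fintype.card I * n ^ 0 [MOD (n - 1)] :=
    (h1.mul_right _).add_right _
  rw [hcount] at h2
  refine Nat.ModEq.add_right_cancel' c ?_
  simpa [add_comm] using h3.symm.trans h2

end ModuleType

section CellIso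

variable {E : Type*} [Ring E] {I J I' J' M : Type*} [Fintype I] [DecidableEq I] [Fintype J]
  [DecidableEq J] [Fintype I'] [DecidableEq I'] [Fintype J'] [DecidableEq J'] [Fintype M]
  [DecidableEq M]

/-- `U` and `V` are mutually inverse isomorphisms between the projective modules attached to the
families of idempotents `p` and `q`. -/
structure IsCellIso (p : I → E) (q : J → E) (U : Matrix J I E) (V : Matrix I J E) : Prop where
  mul_eq : U * V = Matrix.diagonal q
  mul_eq' : V * U = Matrix.diagonal p
  diagonal_mul : Matrix.diagonal q * U = U
  diagonal_mul' : Matrix.diagonal p * V = V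

namespace IsCellIso

variable {p : I → E} {q : J → E} {r : M → E} {p' : I' → E} {q' : J' → E} {U : Matrix J I E}
  {V : Matrix I J E}

theorem symm (h : IsCellIso p q U V) : IsCellIso q p V U :=
  ⟨h.mul_eq', h.mul_eq, h.diagonal_mul', h.diagonal_mul⟩

theorem mul_diagonal (h : IsCellIso p q U V) : U * Matrix.diagonal p = U := by
  rw [← h.mul_eq', ← Matrix.mul_assoc, h.mul_eq, h.diagonal_mul]

theorem refl (hp : ∀ i, IsIdempotentElem (p i)) :
    IsCellIso p p (Matrix.diagonal p) (Matrix.diagonal p) := by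
  have h : Matrix.diagonal p * Matrix.diagonal p = Matrix.diagonal p := by
    rw [Matrix.diagonal_mul_diagonal]
    exact congrArg _ (funext hp)
  exact ⟨h, h, h, h⟩

theorem trans {U' : Matrix M J E} {V' : Matrix J M E} (h : IsCellIso p q U V)
    (h' : IsCellIso q r U' V') : IsCellIso p r (U' * U) (V * V') := by
  refine ⟨?_, ?_, ?_, ?_⟩
  · rw [Matrix.mul_assoc, ← Matrix.mul_assoc U, h.mul_eq, h'.diagonal_mul', h'.mul_eq]
  · rw [Matrix.mul_assoc, ← Matrix.mul_assoc V', h'.mul_eq', h.diagonal_mul, h.mul_eq']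
  · rw [← Matrix.mul_assoc, h'.diagonal_mul]
  · rw [← Matrix.mul_assoc, h.diagonal_mul']

theorem reindex (h : IsCellIso p q U V) (σ : I' ≃ I) (τ : J' ≃ J) :
    IsCellIso (p ∘ σ) (q ∘ τ) (U.submatrix τ σ) (V.submatrix σ τ) := by
  refine ⟨?_, ?_, ?_, ?_⟩
  · rw [← Matrix.submatrix_diagonal_equiv, Matrix.submatrix_mul_equiv, h.mul_eq]
  · rw [← Matrix.submatrix_diagonal_equiv, Matrix.submatrix_mul_equiv, h.mul_eq']
  · rw [← Matrix.submatrix_diagonal_equiv, Matrix.submatrix_mul_equiv, h.diagonal_mul]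
  · rw [← Matrix.submatrix_diagonal_equiv, Matrix.submatrix_mul_equiv, h.diagonal_mul']

theorem sum {U' : Matrix J' I' E} {V' : Matrix I' J' E} (h : IsCellIso p q U V)
    (h' : IsCellIso p' q' U' V') :
    IsCellIso (Sum.elim p p') (Sum.elim q q') (Matrix.fromBlocks U 0 0 U')
      (Matrix.fromBlocks V 0 0 V') := by
  refine ⟨?_, ?_, ?_, ?_⟩ <;> rw [← Matrix.fromBlocks_diagonal, Matrix.fromBlocks_multiply]
  · simp [h.mul_eq, h'.mul_eq]
  · simp [h.mul_eq', h'.mul_eq']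
  · simp [h.diagonal_mul, h'.diagonal_mul]
  · simp [h.diagonal_mul', h'.diagonal_mul']

end IsCellIso

variable {K : Type*} [Field K] [Algebra K E]

/-- Two families of idempotents are linked by an isomorphism with entries in `S`. -/
def CellEquiv (S : Subalgebra K E) (p : I → E) (q : J → E) : Prop :=
  ∃ U V, IsCellIso p q U V ∧ (∀ j i, U j i ∈ S) ∧ ∀ i j, V i j ∈ S

theorem Subalgebra.matrix_mul_mem {I J M : Type*} [Fintype J] (S : Subalgebra K E)
    {A : Matrix I J E} {B : Matrix J M E}
    (hA : ∀ i j, A i j ∈ S) (hB : ∀ i j, B i j ∈ S) (i : I) (j : M) : (A * B) i j ∈ S :=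
  sum_mem fun k _ => mul_mem (hA i k) (hB k j)

namespace CellEquiv

variable {S : Subalgebra K E} {p : I → E} {q : J → E} {r : M → E} {p' : I' → E} {q' : J' → E}

theorem symm : CellEquiv S p q → CellEquiv S q p :=
  fun ⟨U, V, h, hU, hV⟩ => ⟨V, U, h.symm, hV, hU⟩

theorem trans : CellEquiv S p q → CellEquiv S q r → CellEquiv S p r :=
  fun ⟨_, _, h, hU, hV⟩ ⟨_, _, h', hU', hV'⟩ =>
    ⟨_, _, h.trans h', S.matrix_mul_mem hU' hU, S.matrix_mul_mem hV hV'⟩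

theorem sum : CellEquiv S p q → CellEquiv S p' q' → CellEquiv S (Sum.elim p p') (Sum.elim q q') :=
  fun ⟨_, _, h, hU, hV⟩ ⟨_, _, h', hU', hV'⟩ => ⟨_, _, h.sum h', by
    rintro (j | j) (i | i) <;> simp [hU, hU'], by
    rintro (j | j) (i | i) <;> simp [hV, hV']⟩

end CellEquiv

variable {ι : Type} [DecidableEq ι]

/-- The number of times each value is taken by a family. -/
def fiberCard (t : I → ι) (w : ι) : ℕ := Fintype.card {i // t i = w}

theorem fiberCard_sumElim {I J : Type*} [Fintype I] [Fintype J] (t : I → ι) (t' : J → ι) :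
    fiberCard (Sum.elim t t') = fiberCard t + fiberCard t' := by
  funext w
  rw [Pi.add_apply, fiberCard, fiberCard, fiberCard, ← Fintype.card_sum]
  exact Fintype.card_congr (Equiv.subtypeSum)

theorem exists_fiberCard_eq [Fintype ι] (m : ι → ℕ) :
    ∃ (k : ℕ) (t : Fin k → ι), fiberCard t = m := by
  let σ := (Fintype.equivFin (Σ w, Fin (m w))).symm
  refine ⟨_, fun i => (σ i).1, funext fun w => ?_⟩
  have h : {i // (σ i).1 = w} ≃ Fin (m w) :=
    (σ.subtypeEquiv (q := fun c => c.1 = w) fun i => Iff.rfl).trans (Equiv.sigmaSubtype w)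
  rw [fiberCard, Fintype.card_congr h, Fintype.card_fin]

theorem exists_equiv_of_fiberCard_eq {I J : Type*} [Fintype I] [Fintype J] {t : I → ι} {t' : J → ι}
    (h : fiberCard t = fiberCard t') :
    ∃ σ : I ≃ J, ∀ i, t' (σ i) = t i :=
  ⟨Equiv.ofFiberEquiv fun w => Fintype.equivOfCardEq (congrFun h w),
    Equiv.ofFiberEquiv_map _⟩

variable {S : Subalgebra K E} {e : ι → E}

theorem cellEquiv_of_fiberCard_eq (he : ∀ w, IsIdempotentElem (e w)) (hS : ∀ w, e w ∈ S)
    {t : I → ι} {t' : J → ι} (h : fiberCard t = fiberCard t') : CellEquiv S (e ∘ t) (e ∘ t') := by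
  obtain ⟨σ, hσ⟩ := exists_equiv_of_fiberCard_eq h
  have h1 := (IsCellIso.refl (p := e ∘ t') fun j => he _).reindex σ (Equiv.refl J)
  have h2 : (e ∘ t') ∘ σ = e ∘ t := funext fun i => congrArg e (hσ i)
  rw [h2] at h1
  have hd : ∀ i j, Matrix.diagonal (e ∘ t') i j ∈ S := by
    intro i j
    rw [Matrix.diagonal_apply]
    split_ifs
    · exact hS _
    · exact zero_mem S
  exact ⟨_, _, h1, fun _ _ => hd _ _, fun _ _ => hd _ _⟩

variable [Fintype ι]

/-- The congruence on multiplicity vectors given by isomorphisms with entries in `S`. -/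
def cellCon (he : ∀ w, IsIdempotentElem (e w)) (hS : ∀ w, e w ∈ S) : AddCon (ι → ℕ) where
  r m m' := ∀ (k l : ℕ) (t : Fin k → ι) (t' : Fin l → ι), fiberCard t = m → fiberCard t' = m' →
    CellEquiv S (e ∘ t) (e ∘ t')
  iseqv := by
    refine ⟨?_, ?_, ?_⟩
    · intro m k l t t' ht ht'
      exact cellEquiv_of_fiberCard_eq he hS (ht.trans ht'.symm)
    · intro m m' h k l t t' ht ht'
      exact (h _ _ t' t ht' ht).symm
    · intro m m' m'' h h' k l t t' ht ht'
      obtain ⟨_, s, hs⟩ := exists_fiberCard_eq m'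
      exact (h _ _ t s ht hs).trans (h' _ _ s t' hs ht')
  add' := by
    intro m₁ m₂ m₃ m₄ h h' k l t t' ht ht'
    obtain ⟨_, t₁, h₁⟩ := exists_fiberCard_eq m₁
    obtain ⟨_, t₂, h₂⟩ := exists_fiberCard_eq m₂
    obtain ⟨_, t₃, h₃⟩ := exists_fiberCard_eq m₃
    obtain ⟨_, t₄, h₄⟩ := exists_fiberCard_eq m₄
    have h5 := (h _ _ t₁ t₂ h₁ h₂).sum (h' _ _ t₃ t₄ h₃ h₄)
    rw [← Sum.comp_elim, ← Sum.comp_elim] at h5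
    refine (cellEquiv_of_fiberCard_eq he hS ?_).trans
      (h5.trans (cellEquiv_of_fiberCard_eq he hS ?_))
    · rw [ht, fiberCard_sumElim, h₁, h₃]
    · rw [ht', fiberCard_sumElim, h₂, h₄]

theorem cellCon_of_cellEquiv (he : ∀ w, IsIdempotentElem (e w)) (hS : ∀ w, e w ∈ S) {t : I → ι}
    {t' : J → ι} (h : CellEquiv S (e ∘ t) (e ∘ t')) :
    cellCon he hS (fiberCard t) (fiberCard t') := by
  intro k l s s' hs hs'
  exact (cellEquiv_of_fiberCard_eq he hS hs).trans
    (h.trans (cellEquiv_of_fiberCard_eq he hS hs'.symm))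

end CellIso

section System

variable {E : Type*} [Ring E] {ι : Type} [DecidableEq ι]

/-- An isomorphism from the module attached to `e v` to a sum of such modules with multiplicities
`m`, the set of its matrix entries being `G`. -/
def IsRow (e : ι → E) (v : ι) (m : ι → ℕ) (G : Set E) : Prop :=
  ∃ (k : ℕ) (t : Fin k → ι) (U : Matrix (Fin k) Unit E) (V : Matrix Unit (Fin k) E),
    fiberCard t = m ∧ IsCellIso (fun _ => e v) (e ∘ t) U V ∧ G = {a | ∃ i, a = U i () ∨ a = V () i}

/-- A family of isomorphisms with multiplicities `r` whose entries, together with the idempotents,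
generate the algebra. -/
def IsSystem (K : Type*) [Field K] [Algebra K E] (e : ι → E) (r : ι → ι → ℕ) : Prop :=
  ∃ G : ι → Set E, (∀ v, IsRow e v (r v) (G v)) ∧
    Algebra.adjoin K (Set.range e ∪ ⋃ v, G v) = ⊤

variable {K : Type*} [Field K] [Algebra K E] {e : ι → E} {r : ι → ι → ℕ}

theorem fiberCard_unit (v : ι) : fiberCard (fun _ : Unit => v) = Pi.single v 1 := by
  funext w
  rw [fiberCard, Pi.single_apply]
  split_ifs with h
  · simp [h]
  · simp [Ne.symm h]

variable [Fintype ι]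

theorem IsRow.cellCon (he : ∀ w, IsIdempotentElem (e w)) {S : Subalgebra K E} (hS : ∀ w, e w ∈ S)
    {v : ι} {m : ι → ℕ} {G : Set E} (h : IsRow e v m G) (hG : G ⊆ S) :
    cellCon he hS (Pi.single v 1) m := by
  obtain ⟨k, t, U, V, rfl, h, rfl⟩ := h
  rw [← fiberCard_unit]
  exact cellCon_of_cellEquiv he hS ⟨U, V, h, fun i _ => hG ⟨i, Or.inl rfl⟩,
    fun _ i => hG ⟨i, Or.inr rfl⟩⟩

/-- Changing one isomorphism of a system by means of the others. -/
theorem IsSystem.change (he : ∀ w, IsIdempotentElem (e w)) (h : IsSystem K e r) (v : ι)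
    (m : ι → ℕ)
    (H : ∀ c : AddCon (ι → ℕ), (∀ w, w ≠ v → c (Pi.single w 1) (r w)) → c (r v) m) :
    IsSystem K e (Function.update r v m) := by
  obtain ⟨G, hG, htop⟩ := h
  let S : Subalgebra K E := Algebra.adjoin K (Set.range e ∪ ⋃ w ∈ {w | w ≠ v}, G w)
  have hS : ∀ w, e w ∈ S := fun w => Algebra.subset_adjoin (Or.inl ⟨w, rfl⟩)
  have hGS : ∀ w, w ≠ v → G w ⊆ S := fun w hw a ha =>
    Algebra.subset_adjoin (Or.inr (Set.mem_biUnion (show w ∈ {w | w ≠ v} from hw) ha))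
  obtain ⟨k, t, U, V, ht, hUV, hGv⟩ := hG v
  obtain ⟨l, t', ht'⟩ := exists_fiberCard_eq m
  obtain ⟨U', V', hUV', hU', hV'⟩ :=
    H (cellCon he hS) (fun w hw => (hG w).cellCon he hS (hGS w hw)) k l t t' ht ht'
  have hnew := hUV.trans hUV'
  refine ⟨Function.update G v {a | ∃ i, a = (U' * U) i () ∨ a = (V * V') () i}, fun w => ?_, ?_⟩
  · rcases eq_or_ne w v with rfl | hw
    · simp only [Function.update_self]
      exact ⟨l, t', _, _, ht', hnew, rfl⟩
    · simp only [Function.update_of_ne hw]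
      exact hG w
  · rw [eq_top_iff, ← htop]
    refine Algebra.adjoin_le ?_
    set S' := Algebra.adjoin K (Set.range e ∪ ⋃ w, Function.update G v
      {a | ∃ i, a = (U' * U) i () ∨ a = (V * V') () i} w) with hS'
    have hSS' : S ≤ S' := by
      refine Algebra.adjoin_mono (Set.union_subset_union_right _ ?_)
      refine Set.iUnion₂_subset fun w hw => ?_
      refine subset_trans ?_ (Set.subset_iUnion _ w)
      rw [Function.update_of_ne hw]
    have hnewS : {a | ∃ i, a = (U' * U) i () ∨ a = (V * V') () i} ⊆ (S' : Set E) := by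
      refine subset_trans ?_ Algebra.subset_adjoin
      refine subset_trans ?_ Set.subset_union_right
      refine subset_trans ?_ (Set.subset_iUnion _ v)
      rw [Function.update_self]
    refine Set.union_subset ?_ (Set.iUnion_subset fun w => ?_)
    · rintro _ ⟨w, rfl⟩
      exact hSS' (hS w)
    · rcases eq_or_ne w v with rfl | hw
      · have h1 : V' * (U' * U) = U := by
          rw [← Matrix.mul_assoc, hUV'.mul_eq', hUV.diagonal_mul]
        have h2 : V * V' * U' = V := by
          rw [Matrix.mul_assoc, hUV'.mul_eq', hUV.symm.mul_diagonal]
        rw [hGv]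
        rintro _ ⟨i, rfl | rfl⟩
        · rw [← h1]
          exact S'.matrix_mul_mem (fun _ _ => hSS' (hV' _ _)) (fun i _ => hnewS ⟨i, Or.inl rfl⟩) _ _
        · rw [← h2]
          exact S'.matrix_mul_mem (fun _ i => hnewS ⟨i, Or.inr rfl⟩) (fun _ _ => hSS' (hU' _ _)) _ _
      · exact (hGS w hw).trans hSS'

/-- Changing one isomorphism of a system, the condition being checked in commutative monoids. -/
theorem IsSystem.change_of_eq (he : ∀ w, IsIdempotentElem (e w)) (h : IsSystem K e r) (v : ι)
    (m : ι → ℕ)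
    (H : ∀ (Q : Type) [AddCommMonoid Q] (f : ι → Q), (∀ w, w ≠ v → f w = ∑ u, r w u • f u) →
      ∑ u, r v u • f u = ∑ u, m u • f u) :
    IsSystem K e (Function.update r v m) := by
  refine h.change he v m fun c hc => ?_
  have key : ∀ m : ι → ℕ, (m : c.Quotient) = ∑ u, m u • ((Pi.single u 1 : ι → ℕ) : c.Quotient) := by
    intro m
    have h1 : m = ∑ u, m u • Pi.single u 1 := by
      conv_lhs => rw [← Finset.univ_sum_single m]
      simp [← Pi.single_smul]
    conv_lhs => rw [h1]
    exact (map_sum c.mk' _ _).trans (Finset.sum_congr rfl fun u _ => map_nsmul c.mk' _ _)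
  rw [← c.eq, key, key m]
  exact H c.Quotient (fun u => ((Pi.single u 1 : ι → ℕ) : c.Quotient)) fun w hw => by
    rw [← key]
    exact c.eq.2 (hc w hw)

end System

section SingleRow

variable {E : Type*} [Ring E] {ι : Type} {e : ι → E}

/-- Entries of mutually inverse isomorphisms between `e v` and `m` copies of `e w`. -/
structure IsSplitting (e : ι → E) (v w : ι) {m : ℕ} (P Q : Fin m → E) : Prop where
  mul_eq : ∀ i j, P i * Q j = if i = j then e w else 0
  sum_eq : ∑ i, Q i * P i = e v
  mul_left : ∀ i, e w * P i = P i
  mul_right : ∀ i, e v * Q i = Q i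

theorem isCellIso_iff_isSplitting {v w : ι} {m : ℕ} {U : Matrix (Fin m) Unit E}
    {V : Matrix Unit (Fin m) E} :
    IsCellIso (fun _ => e v) (fun _ => e w) U V ↔
      IsSplitting e v w (fun i => U i ()) fun i => V () i := by
  constructor
  · intro h
    refine ⟨fun i j => ?_, ?_, fun i => ?_, fun i => ?_⟩
    · simpa [Matrix.mul_apply, Matrix.diagonal_apply] using congrFun₂ h.mul_eq i j
    · simpa [Matrix.mul_apply] using congrFun₂ h.mul_eq' () ()
    · simpa [Matrix.diagonal_mul] using congrFun₂ h.diagonal_mul i ()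
    · simpa [Matrix.diagonal_mul] using congrFun₂ h.diagonal_mul' () i
  · intro h
    refine ⟨?_, ?_, ?_, ?_⟩ <;> ext i j
    · simpa [Matrix.mul_apply, Matrix.diagonal_apply] using h.mul_eq i j
    · simpa [Matrix.mul_apply] using h.sum_eq
    · simpa [Matrix.diagonal_mul] using h.mul_left i
    · simpa [Matrix.diagonal_mul] using h.mul_right j

theorem IsSplitting.mul_right' {v w : ι} {m : ℕ} {P Q : Fin m → E} (h : IsSplitting e v w P Q)
    (i : Fin m) : Q i * e w = Q i := by
  conv_rhs => rw [← h.mul_right, ← h.sum_eq, Finset.sum_mul]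
  simp [mul_assoc, h.mul_eq]

theorem IsSplitting.mul_left' {v w : ι} {m : ℕ} {P Q : Fin m → E} (h : IsSplitting e v w P Q)
    (i : Fin m) : P i * e v = P i := by
  conv_rhs => rw [← h.mul_left]
  simp [← h.sum_eq, Finset.mul_sum, ← mul_assoc, h.mul_eq]

variable [DecidableEq ι]

theorem fiberCard_const (m : ℕ) (w : ι) : fiberCard (fun _ : Fin m => w) = Pi.single w m := by
  funext u
  rw [fiberCard, Pi.single_apply]
  split_ifs with h
  · simp [h]
  · simp [Ne.symm h]

theorem IsSplitting.isRow {v w : ι} {m : ℕ} {P Q : Fin m → E} (h : IsSplitting e v w P Q) :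
    IsRow e v (Pi.single w m) (Set.range P ∪ Set.range Q) := by
  refine ⟨m, fun _ => w, fun i _ => P i, fun _ i => Q i, fiberCard_const m w,
    isCellIso_iff_isSplitting.2 h, ?_⟩
  ext a
  simp only [Set.mem_union, Set.mem_range, Set.mem_ofPred_eq, exists_or, eq_comm]

theorem IsRow.exists_isSplitting {v w : ι} {m : ℕ} {G : Set E} (h : IsRow e v (Pi.single w m) G) :
    ∃ P Q : Fin m → E, IsSplitting e v w P Q ∧ G = Set.range P ∪ Set.range Q := by
  obtain ⟨k, t, U, V, ht, h, hG⟩ := h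
  have ht' : t = fun _ => w := by
    funext i
    by_contra hi
    have h1 := congrFun ht (t i)
    rw [Pi.single_eq_of_ne hi, fiberCard, Fintype.card_eq_zero_iff] at h1
    exact h1.false ⟨i, rfl⟩
  subst ht'
  rw [fiberCard_const] at ht
  obtain rfl := Pi.single_injective w ht
  refine ⟨_, _, isCellIso_iff_isSplitting.1 h, ?_⟩
  rw [hG]
  ext a
  simp only [Set.mem_union, Set.mem_range, Set.mem_ofPred_eq, exists_or, eq_comm]

end SingleRow

section Corner

/-- A system in which every idempotent is a multiple of `e y`, and `e y` itself is `n` copies of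
itself, has a Leavitt algebra as its corner at `e y`. -/
theorem IsSystem.nonempty_algEquiv {K : Type} [Field K] {E : Type*} [Ring E] [Algebra K E]
    {ι : Type} [Fintype ι] [DecidableEq ι] {e : ι → E} (he : CompleteOrthogonalIdempotents e)
    {y : ι} {k : ι → ℕ} (hn : 2 ≤ k y) (h : IsSystem K e fun v => Pi.single y (k v))
    {A : Type*} [Ring A] [Nontrivial A] [Algebra K A] (κ : E →ₗ[K] A)
    (hκ : Function.Surjective κ) (hκ1 : κ (e y) = 1) (hκm : ∀ a b, κ (a * e y * b) = κ a * κ b) :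
    Nonempty (Leavitt K (k y) ≃ₐ[K] A) := by
  obtain ⟨G, hG, htop⟩ := h
  choose P Q hPQ hGPQ using fun v => (hG v).exists_isSplitting
  have hfam : IsLeavittFamily (fun i => κ (P y i)) fun i => κ (Q y i) := by
    refine ⟨fun i j => ?_, ?_⟩
    · rw [← hκm, mul_assoc, (hPQ y).mul_right, (hPQ y).mul_eq]
      split_ifs <;> simp [hκ1]
    · simp only [← hκm, mul_assoc, (hPQ y).mul_left]
      rw [← map_sum, (hPQ y).sum_eq, hκ1]
  let φ := leavittLift (K := K) hfam
  have hX : ∀ i, κ (P y i) ∈ φ.range := fun i => ⟨_, leavittLift_lx hfam i⟩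
  have hY : ∀ i, κ (Q y i) ∈ φ.range := fun i => ⟨_, leavittLift_ly hfam i⟩
  have hPQ0 : ∀ v w i j, P v i * Q w j = 0 ∨ P v i * Q w j = e y := by
    intro v w i j
    rcases eq_or_ne v w with rfl | hvw
    · rw [(hPQ v).mul_eq]
      split_ifs <;> simp
    · left
      rw [← (hPQ v).mul_left', ← (hPQ w).mul_right, mul_assoc, ← mul_assoc (e v), he.ortho hvw,
        zero_mul, mul_zero]
  have hPr : ∀ v i, κ (P v i * e y) ∈ φ.range := by
    intro v i
    rcases eq_or_ne v y with rfl | hv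
    · rw [(hPQ v).mul_left']
      exact hX i
    · rw [← (hPQ v).mul_left', mul_assoc, he.ortho hv, mul_zero, map_zero]
      exact zero_mem _
  have hQr : ∀ v i, κ (e y * Q v i) ∈ φ.range := by
    intro v i
    rcases eq_or_ne y v with rfl | hv
    · rw [(hPQ y).mul_right]
      exact hY i
    · rw [← (hPQ v).mul_right, ← mul_assoc, he.ortho hv, zero_mul, map_zero]
      exact zero_mem _
  have hPQr : ∀ v w i j, κ (P v i * Q w j) ∈ φ.range := by
    intro v w i j
    rcases hPQ0 v w i j with h | h
    · rw [h, map_zero]; exact zero_mem _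
    · rw [h, hκ1]; exact one_mem _
  have hall : ∀ m : E, ∀ v w i j, κ (P v i * m * Q w j) ∈ φ.range := by
    intro m
    have hm : m ∈ Algebra.adjoin K (Set.range e ∪ ⋃ v, G v) := by rw [htop]; trivial
    induction hm using Algebra.adjoin_induction with
    | mem a ha =>
      intro v w i j
      rcases ha with ⟨u, rfl⟩ | ha
      · rcases eq_or_ne v u with rfl | hv
        · rw [(hPQ v).mul_left']
          exact hPQr v w i j
        · rw [← (hPQ v).mul_left', mul_assoc (P v i), he.ortho hv, mul_zero, zero_mul, map_zero]
          exact zero_mem _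
      · obtain ⟨u, hu⟩ := Set.mem_iUnion.1 ha
        rw [hGPQ] at hu
        rcases hu with ⟨l, rfl⟩ | ⟨l, rfl⟩
        · rw [mul_assoc]
          rcases hPQ0 u w l j with h | h
          · rw [h, mul_zero, map_zero]; exact zero_mem _
          · rw [h]; exact hPr v i
        · rcases hPQ0 v u i l with h | h
          · rw [h, zero_mul, map_zero]; exact zero_mem _
          · rw [h]; exact hQr w j
    | algebraMap c =>
      intro v w i j
      rw [← Algebra.commutes, mul_assoc, ← Algebra.smul_def, map_smul]
      exact Subalgebra.smul_mem _ (hPQr v w i j) c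
    | add a b _ _ iha ihb =>
      intro v w i j
      rw [mul_add, add_mul, map_add]
      exact add_mem (iha v w i j) (ihb v w i j)
    | mul a b _ _ iha ihb =>
      intro v w i j
      have h1 : P v i * (a * b) * Q w j =
          ∑ u, ∑ l, P v i * a * Q u l * e y * (P u l * b * Q w j) := by
        calc P v i * (a * b) * Q w j = P v i * a * (∑ u, e u) * (b * Q w j) := by
              rw [he.complete, mul_one]; simp only [mul_assoc]
          _ = _ := by
            rw [Finset.mul_sum, Finset.sum_mul]
            refine Finset.sum_congr rfl fun u _ => ?_
            rw [← (hPQ u).sum_eq, Finset.mul_sum, Finset.sum_mul]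
            refine Finset.sum_congr rfl fun l _ => ?_
            rw [mul_assoc _ (Q u l) (e y), (hPQ u).mul_right']
            simp only [mul_assoc]
      rw [h1, map_sum]
      refine sum_mem fun u _ => ?_
      rw [map_sum]
      refine sum_mem fun l _ => ?_
      rw [hκm]
      exact mul_mem (iha v u i l) (ihb u w l j)
  refine ⟨AlgEquiv.ofBijective φ ⟨leavittLift_injective hn φ, fun a => ?_⟩⟩
  obtain ⟨m, rfl⟩ := hκ a
  have hy : e y * e y = e y := he.idem y
  have h1 : κ m = κ (e y * m * e y) := by
    have h2 := hκm (e y) m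
    have h3 := hκm (e y * m) (e y)
    rw [mul_assoc (e y * m), hy, hκ1, mul_one] at h3
    rw [hy, hκ1, one_mul] at h2
    rw [h3, h2]
  have h4 : κ (e y * m * e y) ∈ φ.range := by
    rw [← (hPQ y).sum_eq, Finset.sum_mul, Finset.sum_mul, map_sum]
    refine sum_mem fun i _ => ?_
    rw [Finset.mul_sum, map_sum]
    refine sum_mem fun j _ => ?_
    have h5 : Q y i * P y i * m * (Q y j * P y j) =
        Q y i * e y * (P y i * m * Q y j * e y * P y j) := by
      rw [(hPQ y).mul_right', mul_assoc _ (e y) (P y j), (hPQ y).mul_left]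
      simp only [mul_assoc]
    rw [h5, hκm, hκm]
    exact mul_mem (hY i) (mul_mem (hall m y y i j) (hX j))
  rw [← h1] at h4
  exact h4

end Corner

section Blocks

variable {L : Type*} [Ring L] {ι : Type} [DecidableEq ι] (ρ : ι → ℕ)

variable (L) in
/-- The diagonal idempotents of a block decomposition of a matrix algebra. -/
def blockIdem (v : ι) : Matrix (Σ v, Fin (ρ v)) (Σ v, Fin (ρ v)) L :=
  Matrix.diagonal fun c => if c.1 = v then 1 else 0

theorem completeOrthogonalIdempotents_blockIdem [Fintype ι] :
    CompleteOrthogonalIdempotents (blockIdem L ρ) where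
  idem v := by
    rw [IsIdempotentElem, blockIdem, Matrix.diagonal_mul_diagonal]
    congr 1
    funext c
    split_ifs <;> simp
  ortho v w h := by
    simp only [blockIdem, Matrix.diagonal_mul_diagonal]
    rw [← Matrix.diagonal_zero]
    congr 1
    funext c
    by_cases hc : c.1 = v
    · simp [hc, h]
    · simp [hc]
  complete := by
    ext a b
    rw [Matrix.sum_apply]
    by_cases h : a = b
    · subst h
      simp [blockIdem]
    · simp [blockIdem, h]

variable {ρ}

theorem blockIdem_mul_single [Fintype ι] (a b : Σ v, Fin (ρ v)) (l : L) :
    blockIdem L ρ a.1 * Matrix.single a b l = Matrix.single a b l := by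
  ext i j
  rw [blockIdem, Matrix.diagonal_mul, Matrix.single_apply]
  split_ifs <;> simp_all

theorem sum_single_eq_blockIdem (v : ι) :
    ∑ k : Fin (ρ v), Matrix.single (⟨v, k⟩ : Σ v, Fin (ρ v)) ⟨v, k⟩ (1 : L) =
      blockIdem L ρ v := by
  ext ⟨u, i⟩ b
  rw [Matrix.sum_apply]
  by_cases h : (⟨u, i⟩ : Σ v, Fin (ρ v)) = b
  · subst h
    rw [blockIdem, Matrix.diagonal_apply_eq]
    by_cases hu : u = v
    · subst hu
      simp [Matrix.single_apply]
    · simp [hu, Ne.symm hu]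
  · rw [blockIdem, Matrix.diagonal_apply_ne _ h]
    refine Finset.sum_eq_zero fun k _ => ?_
    rw [Matrix.single_apply, if_neg]
    rintro ⟨h1, h2⟩
    exact h (h1.symm.trans h2)

theorem single_eq_blockIdem (o : Σ v, Fin (ρ v)) (ho : ρ o.1 = 1) :
    Matrix.single o o (1 : L) = blockIdem L ρ o.1 := by
  obtain ⟨x, o⟩ := o
  have : Subsingleton (Fin (ρ x)) := by
    rw [show ρ x = 1 from ho]; infer_instance
  rw [← sum_single_eq_blockIdem, Fintype.sum_subsingleton _ o]

variable [Fintype ι]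

/-- The system given by matrix units and the generators of a Leavitt algebra. -/
theorem isSystem_blockIdem {K : Type} [Field K] {n : ℕ} (o : Σ v, Fin (ρ v)) (ho : ρ o.1 = 1) :
    IsSystem K (blockIdem (Leavitt K n) ρ)
      fun v => Pi.single o.1 (if v = o.1 then n else ρ v) := by
  have hrow : ∀ v, ∃ G : Set (Matrix (Σ v, Fin (ρ v)) (Σ v, Fin (ρ v)) (Leavitt K n)),
      IsRow (blockIdem (Leavitt K n) ρ) v (Pi.single o.1 (if v = o.1 then n else ρ v)) G ∧
      (∀ k : Fin (ρ v), v ≠ o.1 → Matrix.single o ⟨v, k⟩ 1 ∈ G ∧ Matrix.single ⟨v, k⟩ o 1 ∈ G) ∧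
      (v = o.1 → ∀ i, Matrix.single o o (lx K n i) ∈ G ∧ Matrix.single o o (ly K n i) ∈ G) := by
    intro v
    by_cases hv : v = o.1
    · subst hv
      have h : IsSplitting (blockIdem (Leavitt K n) ρ) o.1 o.1
          (fun i => Matrix.single o o (lx K n i)) fun i => Matrix.single o o (ly K n i) := by
        refine ⟨fun i j => ?_, ?_, fun i => blockIdem_mul_single _ _ _,
          fun i => blockIdem_mul_single _ _ _⟩
        · rw [Matrix.single_mul_single_same, lx_mul_ly]
          split_ifs
          · exact single_eq_blockIdem o ho
          · simp
        · simp only [Matrix.single_mul_single_same]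
          rw [← single_eq_blockIdem o ho, ← sum_ly_mul_lx K n]
          exact (map_sum (Matrix.singleAddMonoidHom o o : Leavitt K n →+ Matrix _ _ _) _ _).symm
      rw [if_pos rfl]
      refine ⟨_, h.isRow, fun k h => absurd rfl h, fun _ i =>
        ⟨Or.inl ⟨i, rfl⟩, Or.inr ⟨i, rfl⟩⟩⟩
    · have h : IsSplitting (blockIdem (Leavitt K n) ρ) v o.1
          (fun k : Fin (ρ v) => Matrix.single o ⟨v, k⟩ 1) fun k => Matrix.single ⟨v, k⟩ o 1 := by
        refine ⟨fun i j => ?_, ?_, fun i => blockIdem_mul_single o ⟨v, i⟩ _,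
          fun i => blockIdem_mul_single ⟨v, i⟩ o _⟩
        · split_ifs with hij
          · rw [hij, Matrix.single_mul_single_same, mul_one, single_eq_blockIdem o ho]
          · exact Matrix.single_mul_single_of_ne _ _ _ _ (by simpa using hij) _
        · simp only [Matrix.single_mul_single_same, mul_one]
          exact sum_single_eq_blockIdem v
      rw [if_neg hv]
      exact ⟨_, h.isRow, fun k _ => ⟨Or.inl ⟨k, rfl⟩, Or.inr ⟨k, rfl⟩⟩,
        fun h => absurd h hv⟩
  choose G hG hG1 hG2 using hrow
  refine ⟨G, hG, ?_⟩
  set S := Algebra.adjoin K (Set.range (blockIdem (Leavitt K n) ρ) ∪ ⋃ v, G v)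
  have hGS : ∀ {v a}, a ∈ G v → a ∈ S := fun {v a} ha =>
    Algebra.subset_adjoin (Or.inr (Set.mem_iUnion.2 ⟨v, ha⟩))
  have hone : Matrix.single o o 1 ∈ S := by
    rw [single_eq_blockIdem o ho]
    exact Algebra.subset_adjoin (Or.inl ⟨_, rfl⟩)
  have hoo : ∀ l, Matrix.single o o l ∈ S := by
    intro l
    have hl : l ∈ Algebra.adjoin K (Set.range (lx K n) ∪ Set.range (ly K n)) := by
      rw [adjoin_lx_ly]; trivial
    induction hl using Algebra.adjoin_induction with
    | mem a ha =>
      rcases ha with ⟨i, rfl⟩ | ⟨i, rfl⟩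
      · exact hGS (hG2 _ rfl i).1
      · exact hGS (hG2 _ rfl i).2
    | algebraMap c =>
      rw [Algebra.algebraMap_eq_smul_one, ← Matrix.smul_single]
      exact S.smul_mem hone c
    | add a b _ _ iha ihb =>
      rw [Matrix.single_add]
      exact add_mem iha ihb
    | mul a b _ _ iha ihb =>
      rw [← Matrix.single_mul_single_same (j := o)]
      exact mul_mem iha ihb
  have hcol : ∀ c : Σ v, Fin (ρ v), Matrix.single o c 1 ∈ S ∧ Matrix.single c o 1 ∈ S := by
    intro c
    by_cases hc : c.1 = o.1
    · have hco : c = o := by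
        obtain ⟨x, o⟩ := o
        obtain ⟨v, c⟩ := c
        obtain rfl : v = x := hc
        have : Subsingleton (Fin (ρ v)) := by
          rw [show ρ v = 1 from ho]; infer_instance
        rw [Subsingleton.elim c o]
      rw [hco]
      exact ⟨hone, hone⟩
    · exact ⟨hGS (hG1 c.1 c.2 hc).1, hGS (hG1 c.1 c.2 hc).2⟩
  rw [eq_top_iff]
  intro m _
  rw [Matrix.matrix_eq_sum_single m]
  refine sum_mem fun i _ => sum_mem fun j _ => ?_
  have h : Matrix.single i j (m i j) =
      Matrix.single i o 1 * Matrix.single o o (m i j) * Matrix.single o j 1 := by simp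
  rw [h]
  exact mul_mem (mul_mem (hcol i).2 (hoo _)) (hcol j).1

/-- If block systems can be changed so that every idempotent is a multiple of `e y`, the matrix
algebra of size `ρ y` over a Leavitt algebra is a Leavitt algebra. -/
theorem nonempty_algEquiv_of_isSystem_blockIdem {K : Type} [Field K] {n : ℕ} (hn : 2 ≤ n) (y : ι)
    (hy : 1 ≤ ρ y) (k : ι → ℕ) (hk : k y = n)
    (h : IsSystem K (blockIdem (Leavitt K n) ρ) fun v => Pi.single y (k v)) :
    Nonempty (Leavitt K n ≃ₐ[K] Matrix (Fin (ρ y)) (Fin (ρ y)) (Leavitt K n)) := by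
  subst hk
  have := leavitt_nontrivial (K := K) (n := k y) (by omega)
  have : Nonempty (Fin (ρ y)) := ⟨⟨0, hy⟩⟩
  let κ : Matrix (Σ v, Fin (ρ v)) (Σ v, Fin (ρ v)) (Leavitt K (k y)) →ₗ[K]
      Matrix (Fin (ρ y)) (Fin (ρ y)) (Leavitt K (k y)) :=
    { toFun := fun M => Matrix.of fun i j => M ⟨y, i⟩ ⟨y, j⟩
      map_add' := fun _ _ => rfl
      map_smul' := fun _ _ => rfl }
  have hκ : ∀ M i j, κ M i j = M ⟨y, i⟩ ⟨y, j⟩ := fun _ _ _ => rfl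
  refine h.nonempty_algEquiv (completeOrthogonalIdempotents_blockIdem ρ) hn κ ?_ ?_ ?_
  · intro m
    refine ⟨Matrix.of fun a b => if h : a.1 = y ∧ b.1 = y then
      m (h.1 ▸ a.2) (h.2 ▸ b.2) else 0, ?_⟩
    ext i j
    simp [hκ]
  · ext i j
    rw [hκ, blockIdem, Matrix.diagonal_apply, Matrix.one_apply]
    simp
  · intro a b
    ext i j
    rw [hκ, Matrix.mul_apply, Matrix.mul_apply, Fintype.sum_sigma, Finset.sum_eq_single y]
    · simp [hκ, blockIdem, Matrix.mul_diagonal]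
    · intro v _ hv
      simp [blockIdem, Matrix.mul_diagonal, hv]
    · simp

end Blocks

section Necessity

variable {K : Type} [Field K] {n : ℕ}

/-- The matrix algebra of size `d` over `L_n` contains a Leavitt family of size `n'` as soon as
`d * n' = d + k * (n - 1)`. -/
theorem exists_isLeavittFamily_matrix {d n' k : ℕ} (hd : 1 ≤ d)
    (h : n' * d + k = d + k * n) :
    ∃ X Y : Fin n' → Matrix (Fin d) (Fin d) (Leavitt K n), IsLeavittFamily X Y := by
  let e : Unit → Leavitt K n := fun _ => 1
  have he : ∀ w, IsIdempotentElem (e w) := fun _ => IsIdempotentElem.one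
  have hS : ∀ w, e w ∈ (⊤ : Subalgebra K (Leavitt K n)) := fun _ => trivial
  have hspl : IsSplitting e () () (lx K n) (ly K n) :=
    ⟨fun i j => lx_mul_ly K n i j, sum_ly_mul_lx K n, fun _ => one_mul _, fun _ => one_mul _⟩
  have hbase := hspl.isRow.cellCon he hS fun _ _ => trivial
  have hstep : ∀ j l : ℕ, l + j = d + j * n →
      cellCon he hS (Pi.single () d) (Pi.single () l) := by
    intro j
    induction j with
    | zero =>
      rintro l hl
      obtain rfl : l = d := by simpa using hl
      exact (cellCon he hS).refl _
    | succ j ih =>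
      intro l hl
      have hn : d + j * n + n = l + j + 1 := by rw [add_assoc l, hl]; ring
      rcases Nat.eq_zero_or_pos n with h0 | hpos
      · subst h0
        have := (cellCon he hS).add ((cellCon he hS).refl (Pi.single () l)) hbase
        have h1 := ih (l + 1) (by omega)
        rw [← Pi.single_add, ← Pi.single_add] at this
        exact (cellCon he hS).trans h1 this
      · obtain ⟨l', rfl⟩ : ∃ l', l = l' + n := by
          refine ⟨l - n, ?_⟩
          have : j ≤ j * n := Nat.le_mul_of_pos_right j hpos
          omega
        have := (cellCon he hS).add ((cellCon he hS).refl (Pi.single () l')) hbase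
        rw [← Pi.single_add, ← Pi.single_add] at this
        exact (cellCon he hS).trans (ih (l' + 1) (by omega)) this
  obtain ⟨U, V, hUV, -, -⟩ := hstep k _ h _ _ (fun _ : Fin d => ()) (fun _ : Fin (n' * d) => ())
    (fiberCard_const d ()) (fiberCard_const _ ())
  have hre := hUV.reindex (Equiv.refl _) finProdFinEquiv
  refine ⟨fun i => Matrix.of fun a b => U (finProdFinEquiv (i, a)) b,
    fun i => Matrix.of fun a b => V a (finProdFinEquiv (i, b)), fun i j => ?_, ?_⟩
  · ext a b
    have h1 := congrFun₂ hre.mul_eq (i, a) (j, b)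
    rw [Matrix.mul_apply] at h1 ⊢
    refine h1.trans ?_
    rw [Matrix.diagonal_apply]
    by_cases hij : i = j
    · simp [hij, Matrix.one_apply, e]
    · simp [hij]
  · ext a b
    have h1 := congrFun₂ hre.mul_eq' a b
    rw [Matrix.mul_apply, Fintype.sum_prod_type] at h1
    rw [Matrix.sum_apply]
    simp only [Matrix.mul_apply]
    refine h1.trans ?_
    rw [Matrix.diagonal_apply, Matrix.one_apply]
    rfl

theorem IsLeavittFamily.map {A B ι : Type*} [Ring A] [Ring B] [Fintype ι] [DecidableEq ι]
    {X Y : ι → A} (h : IsLeavittFamily X Y) (f : A →+* B) :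
    IsLeavittFamily (f ∘ X) (f ∘ Y) := by
  refine ⟨fun i j => ?_, ?_⟩
  · simp only [Function.comp_apply, ← map_mul, h.mul_eq]
    split_ifs <;> simp
  · simp only [Function.comp_apply, ← map_mul, ← map_sum, h.sum_eq, map_one]

theorem IsLeavittFamily.modEq {k : ℕ} (hn : 2 ≤ n) {X Y : Fin k → Leavitt K n}
    (h : IsLeavittFamily X Y) : k ≡ 1 [MOD (n - 1)] := by
  have := card_modEq_of_mul_eq_one (I := Fin k) (J := Unit) hn (Matrix.of fun i _ => X i)
    (Matrix.of fun _ i => Y i) (by ext i j; simp [Matrix.mul_apply, h.mul_eq, Matrix.one_apply])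
    (by ext; simp [Matrix.mul_apply, h.sum_eq])
  simpa using this

theorem gcd_eq_one_of_algEquiv (hn : 2 ≤ n) {d : ℕ} (hd : 1 ≤ d)
    (φ : Leavitt K n ≃ₐ[K] Matrix (Fin d) (Fin d) (Leavitt K n)) : Nat.gcd d (n - 1) = 1 := by
  obtain ⟨N, rfl⟩ : ∃ N, n = N + 1 := ⟨n - 1, by omega⟩
  rw [Nat.add_sub_cancel]
  obtain ⟨c, hc⟩ := Nat.gcd_dvd_left d N
  obtain ⟨M, hM⟩ := Nat.gcd_dvd_right d N
  have hg : 0 < Nat.gcd d N := Nat.gcd_pos_of_pos_left _ hd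
  have heq : (M + 1) * d + c = d + c * (N + 1) := by
    have : M * d = c * N := by
      conv_lhs => rw [hc]
      conv_rhs => rw [hM]
      ring
    rw [add_mul, this]; ring
  obtain ⟨X, Y, hXY⟩ := exists_isLeavittFamily_matrix (K := K) (n := N + 1) hd heq
  have h := (hXY.map φ.symm.toRingEquiv.toRingHom).modEq hn
  rw [Nat.add_sub_cancel] at h
  have h2 : N ∣ M := by
    have := (Nat.modEq_iff_dvd' (by omega)).1 h.symm
    simpa using this
  have hM0 : 0 < M := Nat.pos_of_ne_zero (by rintro rfl; omega)
  have hle := Nat.le_of_dvd hM0 h2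
  by_contra hne
  have : 2 * M ≤ N := by
    conv_rhs => rw [hM]
    exact Nat.mul_le_mul_right _ (by omega)
  omega

end Necessity

section Moves

/-- Invariance of a property of tables of multiplicities under changing one row by means of the
relations given by the other rows. -/
def IsChangeInvariant {ι : Type} [Fintype ι] [DecidableEq ι] (F : (ι → ι → ℕ) → Prop) : Prop :=
  ∀ r v m, (∀ (Q : Type) [AddCommMonoid Q] (f : ι → Q), (∀ w, w ≠ v → f w = ∑ u, r w u • f u) →
    ∑ u, r v u • f u = ∑ u, m u • f u) → F r → F (Function.update r v m)

/-- The linear combination of four elements with given multiplicities. -/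
def comb {Q : Type} [AddCommMonoid Q] (r : Fin 4 → ℕ) (x y a b : Q) : Q :=
  r 0 • x + r 1 • y + r 2 • a + r 3 • b

theorem comb_cons {Q : Type} [AddCommMonoid Q] (i j k l : ℕ) (x y a b : Q) :
    comb ![i, j, k, l] x y a b = i • x + j • y + k • a + l • b := rfl

variable {F : (Fin 4 → Fin 4 → ℕ) → Prop}

theorem sum_smul_eq_comb {Q : Type} [AddCommMonoid Q] (r : Fin 4 → ℕ) (f : Fin 4 → Q) :
    ∑ u, r u • f u = comb r (f 0) (f 1) (f 2) (f 3) := by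
  rw [Fin.sum_univ_four, comb]

namespace IsChangeInvariant

variable {rx ry ra rb m : Fin 4 → ℕ}

theorem iff_x (hF : IsChangeInvariant F)
    (h : ∀ (Q : Type) [AddCommMonoid Q] (x y a b : Q), y = comb ry x y a b →
      a = comb ra x y a b → b = comb rb x y a b → comb rx x y a b = comb m x y a b) :
    F ![rx, ry, ra, rb] ↔ F ![m, ry, ra, rb] := by
  have h1 := hF ![rx, ry, ra, rb] 0 m fun Q _ f hf => by
    simp only [sum_smul_eq_comb] at hf ⊢
    exact h Q _ _ _ _ (hf 1 (by decide)) (hf 2 (by decide)) (hf 3 (by decide))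
  have h2 := hF ![m, ry, ra, rb] 0 rx fun Q _ f hf => by
    simp only [sum_smul_eq_comb] at hf ⊢
    exact (h Q _ _ _ _ (hf 1 (by decide)) (hf 2 (by decide)) (hf 3 (by decide))).symm
  simp only [Matrix.vecCons, Fin.update_cons_zero] at h1 h2
  exact ⟨h1, h2⟩

theorem iff_y (hF : IsChangeInvariant F)
    (h : ∀ (Q : Type) [AddCommMonoid Q] (x y a b : Q), x = comb rx x y a b →
      a = comb ra x y a b → b = comb rb x y a b → comb ry x y a b = comb m x y a b) :
    F ![rx, ry, ra, rb] ↔ F ![rx, m, ra, rb] := by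
  have hu : ∀ r s, Function.update ![rx, r, ra, rb] 1 s = ![rx, s, ra, rb] := by
    intro r s
    funext v
    fin_cases v <;> rfl
  have h1 := hF ![rx, ry, ra, rb] 1 m fun Q _ f hf => by
    simp only [sum_smul_eq_comb] at hf ⊢
    exact h Q _ _ _ _ (hf 0 (by decide)) (hf 2 (by decide)) (hf 3 (by decide))
  have h2 := hF ![rx, m, ra, rb] 1 ry fun Q _ f hf => by
    simp only [sum_smul_eq_comb] at hf ⊢
    exact (h Q _ _ _ _ (hf 0 (by decide)) (hf 2 (by decide)) (hf 3 (by decide))).symm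
  rw [hu] at h1 h2
  exact ⟨h1, h2⟩

theorem iff_a (hF : IsChangeInvariant F)
    (h : ∀ (Q : Type) [AddCommMonoid Q] (x y a b : Q), x = comb rx x y a b →
      y = comb ry x y a b → b = comb rb x y a b → comb ra x y a b = comb m x y a b) :
    F ![rx, ry, ra, rb] ↔ F ![rx, ry, m, rb] := by
  have hu : ∀ r s, Function.update ![rx, ry, r, rb] 2 s = ![rx, ry, s, rb] := by
    intro r s
    funext v
    fin_cases v <;> rfl
  have h1 := hF ![rx, ry, ra, rb] 2 m fun Q _ f hf => by
    simp only [sum_smul_eq_comb] at hf ⊢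
    exact h Q _ _ _ _ (hf 0 (by decide)) (hf 1 (by decide)) (hf 3 (by decide))
  have h2 := hF ![rx, ry, m, rb] 2 ra fun Q _ f hf => by
    simp only [sum_smul_eq_comb] at hf ⊢
    exact (h Q _ _ _ _ (hf 0 (by decide)) (hf 1 (by decide)) (hf 3 (by decide))).symm
  rw [hu] at h1 h2
  exact ⟨h1, h2⟩

theorem iff_b (hF : IsChangeInvariant F)
    (h : ∀ (Q : Type) [AddCommMonoid Q] (x y a b : Q), x = comb rx x y a b →
      y = comb ry x y a b → a = comb ra x y a b → comb rb x y a b = comb m x y a b) :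
    F ![rx, ry, ra, rb] ↔ F ![rx, ry, ra, m] := by
  have hu : ∀ r s, Function.update ![rx, ry, ra, r] 3 s = ![rx, ry, ra, s] := by
    intro r s
    funext v
    fin_cases v <;> rfl
  have h1 := hF ![rx, ry, ra, rb] 3 m fun Q _ f hf => by
    simp only [sum_smul_eq_comb] at hf ⊢
    exact h Q _ _ _ _ (hf 0 (by decide)) (hf 1 (by decide)) (hf 2 (by decide))
  have h2 := hF ![rx, ry, ra, m] 3 rb fun Q _ f hf => by
    simp only [sum_smul_eq_comb] at hf ⊢
    exact (h Q _ _ _ _ (hf 0 (by decide)) (hf 1 (by decide)) (hf 2 (by decide))).symm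
  rw [hu] at h1 h2
  exact ⟨h1, h2⟩

end IsChangeInvariant
end Moves

section Slides

theorem exists_natCast_sub_eq (α β : ℤ) :
    ∃ i j k l : ℕ, (i : ℤ) - (j + 1 : ℕ) - 1 = α ∧ ((k + 1 : ℕ) : ℤ) - l + 1 = β := by
  refine ⟨(α + 2).toNat, (-(α + 2)).toNat, (β - 2).toNat, (-(β - 2)).toNat, ?_, ?_⟩ <;>
    push_cast <;> omega

/-- Invariance of a property of pairs of relations `a = p x + i a + j b`, `b = q x + k a + l b`
under the moves allowed by `x = x + a + b` and by substituting one relation into the other. -/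
structure IsSlideInvariant (G : ℕ → ℕ → ℕ → ℕ → ℕ → ℕ → Prop) : Prop where
  pad_left : ∀ p i j q k l, 1 ≤ p → (G p i j q k l ↔ G p (i + 1) (j + 1) q k l)
  pad_right : ∀ p i j q k l, 1 ≤ q → (G p i j q k l ↔ G p i j q (k + 1) (l + 1))
  subst_right : ∀ p i j q k l, G p i j q (k + 1) l ↔ G p i j (q + p) (k + i) (l + j)
  subst_left : ∀ p i j q k l, G p i (j + 1) q k l ↔ G (p + q) (i + k) (j + l) q k l

/-- The state reached up to padding, recorded by the differences of the multiplicities. -/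
def SlideState (G : ℕ → ℕ → ℕ → ℕ → ℕ → ℕ → Prop) (p : ℕ) (α : ℤ) (q : ℕ) (β : ℤ) : Prop :=
  ∃ i j k l : ℕ, (i : ℤ) - j - 1 = α ∧ (k : ℤ) - l + 1 = β ∧ G p i j q k l

namespace IsSlideInvariant

variable {G : ℕ → ℕ → ℕ → ℕ → ℕ → ℕ → Prop}

theorem pad_left_add (hG : IsSlideInvariant G) {p : ℕ} (hp : 1 ≤ p) (i j q k l c : ℕ) :
    G p i j q k l ↔ G p (i + c) (j + c) q k l := by
  induction c with
  | zero => rfl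
  | succ c ih => exact ih.trans (hG.pad_left p _ _ q k l hp)

theorem pad_right_add (hG : IsSlideInvariant G) {q : ℕ} (hq : 1 ≤ q) (p i j k l c : ℕ) :
    G p i j q k l ↔ G p i j q (k + c) (l + c) := by
  induction c with
  | zero => rfl
  | succ c ih => exact ih.trans (hG.pad_right p i j q _ _ hq)

theorem slideState_iff (hG : IsSlideInvariant G) {p q : ℕ} (hp : 1 ≤ p) (hq : 1 ≤ q) (i j k l : ℕ)
    {α β : ℤ}
    (hα : (i : ℤ) - j - 1 = α) (hβ : (k : ℤ) - l + 1 = β) :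
    SlideState G p α q β ↔ G p i j q k l := by
  refine ⟨?_, fun h => ⟨i, j, k, l, hα, hβ, h⟩⟩
  rintro ⟨i', j', k', l', hα', hβ', h⟩
  rw [hG.pad_left_add hp _ _ _ _ _ i, hG.pad_right_add hq _ _ _ _ _ k] at h
  rw [hG.pad_left_add hp _ _ _ _ _ i', hG.pad_right_add hq _ _ _ _ _ k']
  convert h using 1 <;> omega

theorem slideState_add_right (hG : IsSlideInvariant G) {p q : ℕ} (hp : 1 ≤ p) (hq : 1 ≤ q)
    (α β : ℤ) :
    SlideState G p α q β ↔ SlideState G p α (q + p) (β + α) := by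
  obtain ⟨i, j, k, l, h1, h2⟩ := exists_natCast_sub_eq α β
  rw [hG.slideState_iff hp hq _ _ _ _ h1 h2, hG.subst_right,
    hG.slideState_iff hp (by omega) i (j + 1) (k + i) (l + (j + 1)) h1 (by push_cast at *; omega)]

theorem slideState_add_left (hG : IsSlideInvariant G) {p q : ℕ} (hp : 1 ≤ p) (hq : 1 ≤ q)
    (α β : ℤ) :
    SlideState G p α q β ↔ SlideState G (p + q) (α + β) q β := by
  obtain ⟨i, j, k, l, h1, h2⟩ := exists_natCast_sub_eq α β
  rw [hG.slideState_iff hp hq _ _ _ _ h1 h2, hG.subst_left,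
    hG.slideState_iff (by omega) hq (i + (k + 1)) (j + l) (k + 1) l (by push_cast at *; omega) h2]

theorem slideState_shift (hG : IsSlideInvariant G) {g : ℕ} (hg : 1 ≤ g) (α β : ℤ) :
    SlideState G g α g β ↔ SlideState G g β g (2 * β - α) := by
  obtain ⟨i, j, h1⟩ : ∃ i j : ℕ, (i : ℤ) - j = α + 2 :=
    ⟨(α + 2).toNat, (-(α + 2)).toNat, by omega⟩
  obtain ⟨k, l, h2⟩ : ∃ k l : ℕ, (k : ℤ) - l = β - α - 2 :=
    ⟨(β - α - 2).toNat, (-(β - α - 2)).toNat, by omega⟩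
  have hC := hG.subst_right g i (j + 1) 0 k l
  have hD := hG.subst_left g i j 0 (k + 1) l
  have hC' := hG.subst_right g (i + (k + 1)) (j + l) 0 k l
  rw [hG.slideState_iff hg hg i (j + 1) (k + i) (l + (j + 1))
      (by push_cast; omega) (by push_cast; omega),
    hG.slideState_iff hg hg (i + (k + 1)) (j + l) (k + (i + (k + 1))) (l + (j + l))
      (by push_cast; omega) (by push_cast; omega)]
  rw [Nat.zero_add, Nat.add_zero] at *
  exact hC.symm.trans (hD.trans hC')

theorem slideState_shift_iterate (hG : IsSlideInvariant G) {g : ℕ} (hg : 1 ≤ g) (α m : ℤ) (c : ℕ) :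
    SlideState G g α g (α + m) ↔ SlideState G g (α + c * m) g (α + c * m + m) := by
  induction c with
  | zero => simp
  | succ c ih =>
    rw [ih, hG.slideState_shift hg]
    push_cast
    ring_nf

theorem slideState_congr (hG : IsSlideInvariant G) {g : ℕ} (hg : 1 ≤ g) {α α' m : ℤ}
    (h : m ∣ α' - α) :
    SlideState G g α g (α + m) ↔ SlideState G g α' g (α' + m) := by
  obtain ⟨c, hc⟩ := h
  obtain ⟨c, rfl | rfl⟩ := c.eq_nat_or_neg
  · rw [hG.slideState_shift_iterate hg α m c, show α' = α + c * m by linarith]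
  · rw [hG.slideState_shift_iterate hg α' m c, show α = α' + c * m by linarith]

/-- The Euclidean algorithm on slide states. -/
theorem exists_slideState_gcd (hG : IsSlideInvariant G) (p q : ℕ) (hp : 1 ≤ p) (hq : 1 ≤ q)
    (α β ℓ N : ℤ)
    (hdet : p * β - q * α = N) (h1 : N ∣ p + ℓ * α) (h2 : N ∣ q + ℓ * β) :
    ∃ A m : ℤ, N ∣ Nat.gcd p q + ℓ * A ∧ Nat.gcd p q * m = N ∧
      (SlideState G p α q β ↔ SlideState G (Nat.gcd p q) A (Nat.gcd p q) (A + m)) := by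
  induction hs : p + q using Nat.strong_induction_on generalizing p q α β with
  | _ s ih =>
    rcases lt_trichotomy p q with h | rfl | h
    · obtain ⟨c, rfl⟩ := Nat.exists_eq_add_of_lt h
      have hg : Nat.gcd p (p + c + 1) = Nat.gcd p (c + 1) := by
        rw [Nat.add_assoc, Nat.gcd_self_add_right]
      have := ih (p + (c + 1)) (by omega) p (c + 1) hp (by omega) α (β - α)
        (by push_cast at *; linarith) h1
        ((dvd_sub h2 h1).trans (dvd_of_eq (by push_cast; ring))) rfl
      rw [hG.slideState_add_right hp (by omega), sub_add_cancel] at this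
      rwa [hg, show p + c + 1 = c + 1 + p by omega]
    · refine ⟨α, β - α, ?_, ?_, ?_⟩
      · rwa [Nat.gcd_self]
      · rw [Nat.gcd_self]
        linarith
      · rw [Nat.gcd_self, add_sub_cancel]
    · obtain ⟨c, rfl⟩ := Nat.exists_eq_add_of_lt h
      have hg : Nat.gcd (q + c + 1) q = Nat.gcd (c + 1) q := by
        rw [Nat.add_assoc, Nat.gcd_self_add_left]
      have := ih (c + 1 + q) (by omega) (c + 1) q (by omega) hq (α - β) β
        (by push_cast at *; linarith)
        ((dvd_sub h1 h2).trans (dvd_of_eq (by push_cast; ring))) h2 rfl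
      rw [hG.slideState_add_left (by omega) hq, sub_add_cancel] at this
      rwa [hg, show q + c + 1 = c + 1 + q by omega]

theorem slideState_iff_of_gcd_eq (hG : IsSlideInvariant G) {p q p' q' : ℕ} (hp : 1 ≤ p)
    (hq : 1 ≤ q) (hp' : 1 ≤ p')
    (hq' : 1 ≤ q') {α β α' β' ℓ N : ℤ} (hdet : p * β - q * α = N)
    (hdet' : p' * β' - q' * α' = N) (h1 : N ∣ p + ℓ * α) (h2 : N ∣ q + ℓ * β)
    (h1' : N ∣ p' + ℓ * α') (h2' : N ∣ q' + ℓ * β') (hgcd : Nat.gcd p q = Nat.gcd p' q')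
    (hg : (Nat.gcd p q : ℤ) = Int.gcd N ℓ) :
    SlideState G p α q β ↔ SlideState G p' α' q' β' := by
  obtain ⟨A, m, hA, hm, h⟩ := hG.exists_slideState_gcd p q hp hq α β ℓ N hdet h1 h2
  obtain ⟨A', m', hA', hm', h'⟩ :=
    hG.exists_slideState_gcd p' q' hp' hq' α' β' ℓ N hdet' h1' h2'
  rw [← hgcd] at hA' hm' h'
  have hpos : 1 ≤ Nat.gcd p q := Nat.gcd_pos_of_pos_left _ hp
  obtain rfl : m = m' := mul_left_cancel₀ (by omega) (hm.trans hm'.symm)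
  rw [h, h']
  refine hG.slideState_congr hpos ?_
  have hd : N ∣ ℓ * (A' - A) := (dvd_sub hA' hA).trans (dvd_of_eq (by ring))
  obtain ⟨w, hw⟩ : (Int.gcd N ℓ : ℤ) ∣ ℓ := Int.gcd_dvd_right ..
  have hd' : m ∣ w * (A' - A) := by
    refine Int.dvd_of_mul_dvd_mul_left (a := (Nat.gcd p q : ℤ)) (by omega) ?_
    rwa [hm, ← mul_assoc, hg, ← hw]
  refine IsCoprime.dvd_of_dvd_mul_left ?_ hd'
  rw [Int.isCoprime_iff_gcd_eq_one]
  have : Int.gcd ((Nat.gcd p q : ℤ) * m) ((Nat.gcd p q : ℤ) * w) = Nat.gcd p q := by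
    rw [hm, hg, ← hw]
    exact_mod_cast hg.symm
  rw [Int.gcd_mul_left, Int.natAbs_natCast] at this
  exact Nat.eq_of_mul_eq_mul_left hpos (this.trans (Nat.mul_one _).symm)

end IsSlideInvariant
end Slides

section Connection

theorem add_mul_smul_of_eq_smul {Q : Type*} [AddCommMonoid Q] {x : Q} {N : ℕ}
    (h : x = (N + 1) • x) (s c : ℕ) : (s + 1 + c * N) • x = (s + 1) • x := by
  induction c with
  | zero => simp
  | succ c ih =>
    calc (s + 1 + (c + 1) * N) • x = (s + c * N) • x + (N + 1) • x := by module
      _ = (s + c * N) • x + x := by rw [← h]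
      _ = (s + 1 + c * N) • x := by module
      _ = (s + 1) • x := ih

theorem gcd_sub_one_dvd {N s t c : ℕ} (h : (s + 1) * (t + 1) = N * c + 1) :
    Nat.gcd N s ∣ t := by
  have h1 : Nat.gcd N s ∣ N * c := (Nat.gcd_dvd_left N s).mul_right c
  have h2 : Nat.gcd N s ∣ s * (t + 1) := (Nat.gcd_dvd_right N s).mul_right _
  refine (Nat.dvd_add_right h2).mp ?_
  rwa [show s * (t + 1) + t = N * c by linarith]

variable {F : (Fin 4 → Fin 4 → ℕ) → Prop}

namespace IsChangeInvariant

theorem isSlideInvariant (hF : IsChangeInvariant F) : IsSlideInvariant fun p i j q k l =>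
    F ![![0, 1, 0, 1], ![1, 0, 1, 0], ![p, 0, i, j], ![q, 0, k, l]] where
  pad_left p i j q k l hp := hF.iff_a fun Q _ x y a b hx hy _ => by
    rw [comb_cons] at hx hy ⊢
    obtain ⟨p, rfl⟩ := Nat.exists_eq_add_of_le hp
    have h : x = x + a + b := by
      calc x = y + b := by rw [hx]; module
        _ = x + a + b := by rw [hy]; module
    calc (1 + p) • x + 0 • y + i • a + j • b = p • x + x + i • a + j • b := by module
      _ = p • x + (x + a + b) + i • a + j • b := by rw [← h]
      _ = (1 + p) • x + 0 • y + (i + 1) • a + (j + 1) • b := by module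
  pad_right p i j q k l hq := hF.iff_b fun Q _ x y a b hx hy _ => by
    rw [comb_cons] at hx hy ⊢
    obtain ⟨q, rfl⟩ := Nat.exists_eq_add_of_le hq
    have h : x = x + a + b := by
      calc x = y + b := by rw [hx]; module
        _ = x + a + b := by rw [hy]; module
    calc (1 + q) • x + 0 • y + k • a + l • b = q • x + x + k • a + l • b := by module
      _ = q • x + (x + a + b) + k • a + l • b := by rw [← h]
      _ = (1 + q) • x + 0 • y + (k + 1) • a + (l + 1) • b := by module
  subst_right p i j q k l := hF.iff_b fun Q _ x y a b _ _ ha => by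
    rw [comb_cons] at ha ⊢
    calc q • x + 0 • y + (k + 1) • a + l • b = q • x + k • a + l • b + a := by module
      _ = q • x + k • a + l • b + (p • x + 0 • y + i • a + j • b) := by rw [← ha]
      _ = (q + p) • x + 0 • y + (k + i) • a + (l + j) • b := by module
  subst_left p i j q k l := hF.iff_a fun Q _ x y a b _ _ hb => by
    rw [comb_cons] at hb ⊢
    calc p • x + 0 • y + i • a + (j + 1) • b = p • x + i • a + j • b + b := by module
      _ = p • x + i • a + j • b + (q • x + 0 • y + k • a + l • b) := by rw [← hb]
      _ = (p + q) • x + 0 • y + (i + k) • a + (j + l) • b := by module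

theorem reduce_rank (hF : IsChangeInvariant F) {N s c t : ℕ} (ry : Fin 4 → ℕ)
    (h : ∀ (Q : Type) [AddCommMonoid Q] (x y a b : Q), x = (N + 1) • x → a = s • x → b = t • x →
      (s + 1) • x = comb ry x y a b) :
    F ![![N + 1, 0, 0, 0], ![s + 1 + c * N, 0, 0, 0], ![s, 0, 0, 0], ![t, 0, 0, 0]] ↔
      F ![![N + 1, 0, 0, 0], ry, ![s, 0, 0, 0], ![t, 0, 0, 0]] :=
  hF.iff_y fun Q _ x y a b hx ha hb => by
    simp only [comb_cons, zero_smul, add_zero] at hx ha hb ⊢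
    rw [add_mul_smul_of_eq_smul hx, h Q x y a b hx ha hb]

theorem exists_column_of_one (hF : IsChangeInvariant F) {N c t : ℕ}
    (h : F ![![N + 1, 0, 0, 0], ![0 + 1 + c * N, 0, 0, 0], ![0, 0, 0, 0], ![t, 0, 0, 0]]) :
    ∃ k i j : ℕ, F ![![0, k, 0, 0], ![0, N + 1, 0, 0], ![0, i, 0, 0], ![0, j, 0, 0]] := by
  rw [hF.reduce_rank ![N + 1, 0, 0, 0] fun Q _ x y a b hx ha hb => by
      rw [comb_cons, ← hx]
      module,
    hF.iff_x (m := ![0, 1, 0, 0]) fun Q _ x y a b hy ha hb => by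
      rw [comb_cons] at hy ⊢
      rw [comb_cons, ← hy]
      module,
    hF.iff_y (m := ![0, N + 1, 0, 0]) fun Q _ x y a b hx ha hb => by
      rw [comb_cons] at hx ⊢
      rw [comb_cons, hx]
      module,
    hF.iff_a (m := ![0, 0, 0, 0]) fun Q _ x y a b hx hy hb => rfl,
    hF.iff_b (m := ![0, t, 0, 0]) fun Q _ x y a b hx hy hb => by
      rw [comb_cons] at hx ⊢
      rw [comb_cons, hx]
      module] at h
  exact ⟨_, _, _, h⟩

theorem start_iff (hF : IsChangeInvariant F) {s t c : ℕ} :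
    F ![![s + t + 1, 0, 0, 0], ![s + 1 + c * (s + t), 0, 0, 0], ![s, 0, 0, 0], ![t, 0, 0, 0]] ↔
      F ![![0, 1, 0, 1], ![1, 0, 1, 0], ![s, 0, 0, 0], ![t, 0, 0, 0]] := by
  rw [hF.reduce_rank ![1, 0, 1, 0] fun Q _ x y a b hx ha hb => by
      rw [comb_cons, ha]
      module,
    hF.iff_x (m := ![0, 1, 0, 1]) fun Q _ x y a b hy ha hb => by
      rw [comb_cons] at hy ha hb ⊢
      rw [comb_cons]
      calc _ = 1 • x + 0 • y + 1 • (s • x + 0 • y + 0 • a + 0 • b) + 0 • b +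
            (t • x + 0 • y + 0 • a + 0 • b) := by module
        _ = y + b := by rw [← ha, ← hb, ← hy]
        _ = _ := by module]

theorem finish_iff (hF : IsChangeInvariant F) {s t : ℕ} :
    F ![![0, 1, 0, 1], ![1, 0, 1, 0], ![s, 0, s, 0], ![t, 0, t, 0]] ↔
      F ![![0, t + 1, 0, 0], ![0, s + t + 1, 0, 0], ![0, s, 0, 0], ![0, t, 0, 0]] := by
  rw [hF.iff_a (m := ![0, s, 0, 0]) fun Q _ x y a b hx hy hb => by
      rw [comb_cons] at hy ⊢
      rw [comb_cons, hy]
      module,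
    hF.iff_b (m := ![0, t, 0, 0]) fun Q _ x y a b hx hy ha => by
      rw [comb_cons] at hy ⊢
      rw [comb_cons, hy]
      module,
    hF.iff_x (m := ![0, t + 1, 0, 0]) fun Q _ x y a b hy ha hb => by
      rw [comb_cons] at hb ⊢
      rw [comb_cons, hb]
      module,
    hF.iff_y (m := ![0, s + t + 1, 0, 0]) fun Q _ x y a b hx ha hb => by
      rw [comb_cons] at hx ha ⊢
      rw [comb_cons, hx, ha]
      module]

theorem slide_iff (hF : IsChangeInvariant F) {s t s' t' e : ℕ} (hs : 1 ≤ s) (ht : 1 ≤ t)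
    (hs' : 1 ≤ s') (ht' : 1 ≤ t')
    (hsum : s + t = s' + t') (he : (s + 1) * (t' + 1) = (s + t) * e + 1) :
    F ![![0, 1, 0, 1], ![1, 0, 1, 0], ![s, 0, 0, 0], ![t, 0, 0, 0]] ↔
      F ![![0, 1, 0, 1], ![1, 0, 1, 0], ![s', 0, s', 0], ![t', 0, t', 0]] := by
  have hG := hF.isSlideInvariant
  have hst : Nat.gcd s t = Nat.gcd (s + t) s := by
    rw [Nat.gcd_comm (s + t) s, Nat.gcd_self_add_right]
  have hst' : Nat.gcd s' t' = Nat.gcd (s + t) t' := by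
    rw [hsum, Nat.gcd_add_self_left]
  have hgcd : Nat.gcd (s + t) s = Nat.gcd (s + t) t' := by
    refine Nat.dvd_antisymm (Nat.dvd_gcd (Nat.gcd_dvd_left _ _) (gcd_sub_one_dvd he))
      (Nat.dvd_gcd (Nat.gcd_dvd_left _ _) (gcd_sub_one_dvd (c := e) ?_))
    rwa [mul_comm]
  have hsum' : (s : ℤ) + t = s' + t' := by exact_mod_cast hsum
  have he' : ((s : ℤ) + 1) * (t' + 1) = (s + t) * e + 1 := by exact_mod_cast he
  have := hG.slideState_iff_of_gcd_eq (α := -1) (β := 1) (α' := s' - 1) (β' := t' + 1)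
    (ℓ := s) (N := (s + t : ℕ)) hs ht hs' ht' (by push_cast; ring)
    (by push_cast; rw [hsum']; ring) ⟨0, by ring⟩ ⟨1, by push_cast; ring⟩
    ⟨s + 1 - e, by push_cast; linear_combination -he' - (s + 1) * hsum'⟩
    ⟨e, by push_cast; linear_combination he'⟩
    (by rw [hst, hst', hgcd]) (by rw [hst, Int.gcd_natCast_natCast])
  rwa [hG.slideState_iff hs ht 0 0 0 0 (by simp) (by simp),
    hG.slideState_iff hs' ht' s' 0 t' 0 (by simp) (by simp)] at this

/-- The table expressing four elements as multiples of the first can be changed into one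
expressing them as multiples of the second. -/
theorem exists_column (hF : IsChangeInvariant F) {N s t c : ℕ} (hN : N = s + t) (ht : 1 ≤ t)
    (hco : Nat.Coprime (s + 1) N)
    (h : F ![![N + 1, 0, 0, 0], ![s + 1 + c * N, 0, 0, 0], ![s, 0, 0, 0], ![t, 0, 0, 0]]) :
    ∃ k i j : ℕ, F ![![0, k, 0, 0], ![0, N + 1, 0, 0], ![0, i, 0, 0], ![0, j, 0, 0]] := by
  subst hN
  rcases Nat.eq_zero_or_pos s with rfl | hs
  · exact hF.exists_column_of_one h
  have ht1 : t ≠ 1 := by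
    rintro rfl
    rw [Nat.coprime_self] at hco
    omega
  obtain ⟨m, -, hm⟩ := Nat.exists_mul_mod_eq_one_of_coprime hco (by omega)
  have he : (s + 1) * (m % (s + t)) % (s + t) = 1 := by rwa [Nat.mul_mod_mod]
  have hlt : m % (s + t) < s + t := Nat.mod_lt _ (by omega)
  generalize m % (s + t) = e at he hlt
  have he0 : e ≠ 0 := by
    rintro rfl
    simp at he
  have he1 : e ≠ 1 := by
    rintro rfl
    rw [mul_one, Nat.mod_eq_of_lt (by omega)] at he
    omega
  obtain ⟨u, rfl⟩ := Nat.exists_eq_add_of_le' (show 1 ≤ e by omega)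
  obtain ⟨v, hv⟩ := Nat.exists_eq_add_of_lt hlt
  rw [hF.start_iff, hF.slide_iff (s' := v + 2) (t' := u) (e := (s + 1) * (u + 1) / (s + t))
    hs ht (by omega) (by omega) (by omega) (by
      conv_lhs => rw [← Nat.div_add_mod ((s + 1) * (u + 1)) (s + t), he]), hF.finish_iff,
    show v + 2 + u = s + t by omega] at h
  exact ⟨_, _, _, h⟩

end IsChangeInvariant
end Connection

theorem nonempty_algEquiv_of_gcd_eq_one (K : Type) [Field K] (n : ℕ) (hn : 2 ≤ n) (d : ℕ)
    (hd : 1 ≤ d) (hgcd : Nat.gcd d (n - 1) = 1) :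
    Nonempty (Leavitt K n ≃ₐ[K] Matrix (Fin d) (Fin d) (Leavitt K n)) := by
  obtain ⟨N, rfl⟩ := Nat.exists_eq_add_of_le' (show 1 ≤ n by omega)
  rw [Nat.add_sub_cancel] at hgcd
  have hs : (d - 1) % N < N := Nat.mod_lt _ (by omega)
  obtain ⟨s, c, t, hN, ht, hdc⟩ : ∃ s c t, N = s + t ∧ 1 ≤ t ∧ d = s + 1 + c * N := by
    refine ⟨(d - 1) % N, (d - 1) / N, N - (d - 1) % N, by omega, by omega, ?_⟩
    have := Nat.mod_add_div' (d - 1) N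
    omega
  have hco : Nat.Coprime (s + 1) N := by
    rwa [hdc, Nat.gcd_add_mul_right_left] at hgcd
  set ρ : Fin 4 → ℕ := ![1, d, s, t] with hρ
  have hF : IsChangeInvariant fun r => IsSystem K (blockIdem (Leavitt K (N + 1)) ρ) r :=
    fun r v m H hr =>
      hr.change_of_eq (completeOrthogonalIdempotents_blockIdem ρ).idem v m H
  have h0 := isSystem_blockIdem (K := K) (n := N + 1) (ρ := ρ) ⟨0, ⟨0, Nat.one_pos⟩⟩ rfl
  obtain ⟨k, i, j, h⟩ := hF.exists_column (c := c) hN ht hco (by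
    convert h0 using 1
    funext v u
    fin_cases v <;> fin_cases u <;> simp [hρ, hdc])
  refine nonempty_algEquiv_of_isSystem_blockIdem (ρ := ρ) hn 1 hd ![k, N + 1, i, j] rfl ?_
  convert h using 1
  funext v u
  fin_cases v <;> fin_cases u <;> simp

/-- `L_n ≅ M_d(L_n)` as `K`-algebras if and only if `gcd d (n-1) = 1`. -/
theorem leavitt_iso_matrix_iff_gcd_eq_one (K : Type) [Field K] (n : ℕ) (hn : 2 ≤ n)
    (d : ℕ) (hd : 1 ≤ d) :
    Nonempty (Leavitt K n ≃ₐ[K] Matrix (Fin d) (Fin d) (Leavitt K n)) ↔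
      Nat.gcd d (n - 1) = 1 :=
  ⟨fun ⟨φ⟩ => gcd_eq_one_of_algEquiv hn hd φ, nonempty_algEquiv_of_gcd_eq_one K n hn d hd⟩
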